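/- arXiv:1206.4749 — 8 statements merged into one kernel-verified Lean document; each statement's English description precedes it below -/
import Mathlib

section
/- Let X be a Banach space, I ⊆ ℝ an arbitrary interval, ε₀ > 0 and k ∈ ℕ₀. If φ : I → X is locally Bochner integrable on I and for every h ∈ (0, ε₀] the difference function Δ_h φ : t ↦ φ(t+h) − φ(t) is k-times continuously differentiable on the set I⁻ʰ := {t ∈ I : t + h ∈ I}, then φ is k-times continuously differentiable on I. -/
open MeasureTheory Set
open Filter Topology Metric
open scoped Interval

section Differences

variable {X : Type*} [NormedAddCommGroup X]

/-- Averaging the translates of an integrable function over a set of finite measure gives a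
continuous function. -/
lemma continuous_setIntegral_comp_add [NormedSpace ℝ X] {φ : ℝ → X} (hφ : Integrable φ)
    {E : Set ℝ} (hE : volume E ≠ ⊤) :
    Continuous fun t => ∫ h in E, φ (t + h) := by
  have : IsFiniteMeasure (volume.restrict E) := ⟨by simpa using hE.lt_top⟩
  apply continuous_of_uniform_approx_of_continuous
  intro u hu
  obtain ⟨ε, hε, hεu⟩ := Metric.mem_uniformity_dist.1 hu
  obtain ⟨g, hg, hgφ, hgc, hgi⟩ := hφ.exists_hasCompactSupport_integral_sub_le (half_pos hε)
  refine ⟨fun t => ∫ h in E, g (t + h), ?_, fun t => hεu ?_⟩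
  · obtain ⟨C, hC⟩ := hg.exists_bound_of_continuous hgc
    exact continuous_of_dominated (bound := fun _ => C)
      (fun t => Continuous.aestronglyMeasurable (by fun_prop))
      (fun t => .of_forall fun h => hC (t + h)) (integrable_const _)
      (.of_forall fun h => by fun_prop)
  · have h1 : Integrable fun h => φ (t + h) := hφ.comp_add_left t
    have h2 : Integrable fun h => g (t + h) := hgi.comp_add_left t
    rw [dist_eq_norm, ← integral_sub h1.integrableOn h2.integrableOn]
    calc ‖∫ h in E, (φ (t + h) - g (t + h))‖
        ≤ ∫ h in E, ‖φ (t + h) - g (t + h)‖ := norm_integral_le_integral_norm _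
      _ ≤ ∫ h, ‖φ (t + h) - g (t + h)‖ :=
          setIntegral_le_integral (h1.sub h2).norm (.of_forall fun _ => norm_nonneg _)
      _ = ∫ h, ‖φ h - g h‖ := integral_add_left_eq_self (fun h => ‖φ h - g h‖) t
      _ < ε := by linarith

/-- If the small differences of a measurable function are bounded and continuous on an open set,
then on some set of shifts of positive measure they are uniformly bounded. -/
lemma exists_pos_measure_forall_norm_sub_le {φ : ℝ → X} (hφ : AEStronglyMeasurable φ)
    {V : Set ℝ} (hV : IsOpen V) {r : ℝ} (hr : 0 < r)
    (hb : ∀ h ∈ Ioo 0 r, ∃ M : ℝ, ∀ t ∈ V, ‖φ (t + h) - φ t‖ ≤ M)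
    (hc : ∀ h ∈ Ioo 0 r, ContinuousOn (fun t => φ (t + h) - φ t) V) :
    ∃ (E : Set ℝ) (M : ℝ), E ⊆ Ioo 0 r ∧ NullMeasurableSet E ∧ 0 < volume E ∧
      ∀ h ∈ E, ∀ t ∈ V, ‖φ (t + h) - φ t‖ ≤ M := by
  let D : Set ℝ := range ((↑) : ℚ → ℝ)
  have hD : Dense D := Rat.denseRange_cast
  let E : ℕ → Set ℝ := fun n => Ioo 0 r ∩ ⋂ t ∈ V ∩ D, {h | ‖φ (t + h) - φ t‖ ≤ n}
  have hE : ⋃ n, E n = Ioo 0 r := by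
    refine (iUnion_subset fun n => inter_subset_left).antisymm fun h hh => ?_
    obtain ⟨M, hM⟩ := hb h hh
    obtain ⟨n, hn⟩ := exists_nat_ge M
    exact mem_iUnion.2 ⟨n, hh, mem_iInter₂.2 fun t ht => (hM t ht.1).trans hn⟩
  obtain ⟨n, hn⟩ := exists_measure_pos_of_not_measure_iUnion_null (μ := volume) (s := E)
    (by rw [hE]; simpa using hr)
  refine ⟨E n, n, inter_subset_left, ?_, hn, fun h hh t ht => ?_⟩
  · refine measurableSet_Ioo.nullMeasurableSet.inter
      (NullMeasurableSet.biInter ((countable_range _).mono inter_subset_right) fun t _ => ?_)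
    have hm : AEStronglyMeasurable fun h => φ (t + h) :=
      hφ.comp_quasiMeasurePreserving (measurePreserving_add_left volume t).quasiMeasurePreserving
    exact nullMeasurableSet_le (hm.sub aestronglyMeasurable_const).norm.aemeasurable
      aemeasurable_const
  · have : (𝓝[V ∩ D] t).NeBot :=
      mem_closure_iff_nhdsWithin_neBot.1 (hD.open_subset_closure_inter hV ht)
    have hct := ((hc h hh.1 t ht).mono (inter_subset_left (t := D))).norm
    exact le_of_tendsto hct (eventually_mem_nhdsWithin.mono fun s hs => mem_iInter₂.1 hh.2 s hs)

/-- An integrable function whose small differences are continuous near `t₀` is continuous at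
`t₀`. -/
lemma continuousAt_of_continuousOn_sub [NormedSpace ℝ X] [CompleteSpace X] {φ : ℝ → X}
    (hφ : Integrable φ) {t₀ r : ℝ} (hr : 0 < r)
    (hc : ∀ h ∈ Ioo 0 r, ContinuousOn (fun t => φ (t + h) - φ t) (closedBall t₀ r)) :
    ContinuousAt φ t₀ := by
  obtain ⟨E, M, hEr, hE, hpos, hM⟩ := exists_pos_measure_forall_norm_sub_le
    hφ.aestronglyMeasurable (isOpen_ball (x := t₀) (ε := r)) hr
    (fun h hh => by
      obtain ⟨M, hM⟩ := (isCompact_closedBall t₀ r).exists_bound_of_continuousOn (hc h hh)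
      exact ⟨M, fun t ht => hM t (ball_subset_closedBall ht)⟩)
    (fun h hh => (hc h hh).mono ball_subset_closedBall)
  have hfin : volume E ≠ ⊤ := measure_ne_top_of_subset hEr (by simp)
  have : IsFiniteMeasure (volume.restrict E) := ⟨by simpa using hfin.lt_top⟩
  have hne : volume.real E ≠ 0 := (ENNReal.toReal_pos hpos.ne' hfin).ne'
  have hint (t : ℝ) : IntegrableOn (fun h => φ (t + h)) E := (hφ.comp_add_left t).integrableOn
  have key : φ = fun t => (volume.real E)⁻¹ •
      ((∫ h in E, φ (t + h)) - ∫ h in E, (φ (t + h) - φ t)) := by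
    ext t
    rw [integral_sub (hint t) (integrable_const _), sub_sub_cancel, setIntegral_const,
      smul_smul, inv_mul_cancel₀ hne, one_smul]
  rw [key]
  refine ContinuousAt.const_smul (ContinuousAt.sub
    (continuous_setIntegral_comp_add hφ hfin).continuousAt ?_) _
  refine continuousAt_of_dominated (bound := fun _ => M)
    (.of_forall fun t => ((hint t).sub (integrable_const _)).aestronglyMeasurable) ?_
    (integrable_const _) ?_
  · filter_upwards [ball_mem_nhds t₀ hr] with t ht
    filter_upwards [ae_restrict_mem₀ hE] with h hh using hM h hh t ht
  · filter_upwards [ae_restrict_mem₀ hE] with h hh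
    exact (hc h (hEr hh)).continuousAt (closedBall_mem_nhds t₀ hr)

lemma continuousOn_of_continuousOn_sub [NormedSpace ℝ X] [CompleteSpace X] {φ : ℝ → X} {U : Set ℝ}
    (hU : IsOpen U) (hφ : LocallyIntegrableOn φ U) {ε : ℝ} (hε : 0 < ε)
    (hc : ∀ h ∈ Ioc 0 ε, ContinuousOn (fun t => φ (t + h) - φ t) {t ∈ U | t + h ∈ U}) :
    ContinuousOn φ U := by
  intro t₀ ht₀
  obtain ⟨ρ, hρ, hρU⟩ := Metric.nhds_basis_closedBall.mem_iff.1 (hU.mem_nhds ht₀)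
  obtain ⟨r, hr, hrρ, hrε⟩ : ∃ r > 0, 2 * r ≤ ρ ∧ r ≤ ε :=
    ⟨min (ρ / 2) ε, by positivity, by linarith [min_le_left (ρ / 2) ε], min_le_right _ _⟩
  have hmem : ∀ t ∈ closedBall t₀ r, t ∈ closedBall t₀ ρ := fun t ht =>
    closedBall_subset_closedBall (by linarith) ht
  have hmem' : ∀ t ∈ closedBall t₀ r, ∀ h ∈ Ioo 0 r, t + h ∈ closedBall t₀ ρ := by
    intro t ht h hh
    rw [Real.closedBall_eq_Icc] at ht ⊢
    exact ⟨by linarith [ht.1, hh.1], by linarith [ht.2, hh.2]⟩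
  have hint : Integrable ((closedBall t₀ ρ).indicator φ) :=
    (hφ.integrableOn_compact_subset hρU (isCompact_closedBall _ _)).integrable_indicator
      measurableSet_closedBall
  have hcont := continuousAt_of_continuousOn_sub hint hr (t₀ := t₀) fun h hh =>
    ((hc h ⟨hh.1, hh.2.le.trans hrε⟩).mono fun t ht =>
      ⟨hρU (hmem t ht), hρU (hmem' t ht h hh)⟩).congr fun t ht => by
        simp only [indicator_of_mem (hmem t ht), indicator_of_mem (hmem' t ht h hh)]
  refine (hcont.congr ?_).continuousWithinAt
  filter_upwards [closedBall_mem_nhds t₀ hρ] with t ht using indicator_of_mem ht φ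

/-- By Baire's theorem, the small differences of a continuous function are uniformly Lipschitz for
an interval of shifts, provided each of them is Lipschitz. -/
lemma exists_Icc_forall_norm_sub_sub_le {φ : ℝ → X} (hφ : Continuous φ) {K : Set ℝ} {r : ℝ}
    (hr : 0 < r)
    (hL : ∀ h ∈ Ioo 0 r, ∃ M : ℝ, ∀ s ∈ K, ∀ t ∈ K,
      ‖(φ (t + h) - φ t) - (φ (s + h) - φ s)‖ ≤ M * ‖t - s‖) :
    ∃ a b M : ℝ, a < b ∧ Icc a b ⊆ Ioo 0 r ∧ 0 ≤ M ∧ ∀ h ∈ Icc a b, ∀ s ∈ K, ∀ t ∈ K,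
      ‖(φ (t + h) - φ t) - (φ (s + h) - φ s)‖ ≤ M * ‖t - s‖ := by
  let C : ℕ → Set ℝ := fun n => ⋂ s ∈ K, ⋂ t ∈ K,
    {h | ‖(φ (t + h) - φ t) - (φ (s + h) - φ s)‖ ≤ n * ‖t - s‖}
  have hC (n : ℕ) : IsClosed (C n) :=
    isClosed_biInter fun s _ => isClosed_biInter fun t _ =>
      isClosed_le (by fun_prop) continuous_const
  have hcover : ⋃ n, (C n ∪ (Ioo 0 r)ᶜ) = univ := by
    refine eq_univ_of_forall fun h => ?_
    by_cases hh : h ∈ Ioo 0 r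
    · obtain ⟨M, hM⟩ := hL h hh
      obtain ⟨n, hn⟩ := exists_nat_ge M
      refine mem_iUnion.2 ⟨n, .inl (mem_iInter₂.2 fun s hs => mem_iInter₂.2 fun t ht => ?_)⟩
      exact (hM s hs t ht).trans (by gcongr)
    · exact mem_iUnion.2 ⟨0, .inr hh⟩
  obtain ⟨h₀, hh₀, hh₀'⟩ := (dense_iUnion_interior_of_closed
    (fun n => (hC n).union isOpen_Ioo.isClosed_compl) hcover).inter_open_nonempty
      (Ioo 0 r) isOpen_Ioo (nonempty_Ioo.2 hr)
  obtain ⟨n, hn⟩ := mem_iUnion.1 hh₀'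
  obtain ⟨δ, hδ, hδn⟩ := Metric.nhds_basis_closedBall.mem_iff.1
    (inter_mem (isOpen_Ioo.mem_nhds hh₀) (mem_interior_iff_mem_nhds.1 hn))
  rw [Real.closedBall_eq_Icc] at hδn
  refine ⟨h₀ - δ, h₀ + δ, n, by linarith, fun h hh => (hδn hh).1, n.cast_nonneg, ?_⟩
  intro h hh s hs t ht
  have hhC : h ∈ C n := (hδn hh).2.resolve_right fun hc => hc (hδn hh).1
  exact mem_iInter₂.1 (mem_iInter₂.1 hhC s hs) t ht

lemma contDiff_one_intervalIntegral_comp_add [NormedSpace ℝ X] [CompleteSpace X] {φ : ℝ → X}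
    (hφ : Continuous φ) (a b : ℝ) : ContDiff ℝ 1 fun t => ∫ h in a..b, φ (t + h) := by
  have hG : ContDiff ℝ 1 fun x => ∫ s in (0 : ℝ)..x, φ s := by
    rw [contDiff_one_iff_deriv]
    refine ⟨fun x => (hφ.integral_hasStrictDerivAt 0 x).hasDerivAt.differentiableAt, ?_⟩
    simpa only [funext fun x => hφ.deriv_integral φ 0 x] using hφ
  have key : (fun t => ∫ h in a..b, φ (t + h)) =
      fun t => (∫ s in (0 : ℝ)..(t + b), φ s) - ∫ s in (0 : ℝ)..(t + a), φ s := by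
    ext t
    rw [intervalIntegral.integral_comp_add_left (f := φ),
      intervalIntegral.integral_interval_sub_left] <;> exact hφ.intervalIntegrable _ _
  rw [key]
  exact (hG.comp (contDiff_id.add contDiff_const)).sub
    (hG.comp (contDiff_id.add contDiff_const))

/-- A continuous function whose small differences are `C¹` near `t₀` is `C¹` near `t₀`. -/
lemma contDiffAt_one_of_contDiffOn_sub [NormedSpace ℝ X] [CompleteSpace X] {φ : ℝ → X}
    (hφ : Continuous φ) {t₀ r : ℝ} (hr : 0 < r)
    (hc : ∀ h ∈ Ioo 0 r, ContDiffOn ℝ 1 (fun t => φ (t + h) - φ t) (ball t₀ (2 * r))) :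
    ContDiffAt ℝ 1 φ t₀ := by
  have hsub : closedBall t₀ r ⊆ ball t₀ (2 * r) := closedBall_subset_ball (by linarith)
  have hdiff : ∀ h ∈ Ioo 0 r, ∀ t ∈ closedBall t₀ r,
      DifferentiableAt ℝ (fun t => φ (t + h) - φ t) t := fun h hh t ht =>
    ((hc h hh).differentiableOn one_ne_zero).differentiableAt
      (isOpen_ball.mem_nhds (hsub ht))
  have hderiv : ∀ h ∈ Ioo 0 r,
      ContinuousOn (deriv fun t => φ (t + h) - φ t) (closedBall t₀ r) := fun h hh =>
    ((hc h hh).continuousOn_deriv_of_isOpen isOpen_ball le_rfl).mono hsub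
  obtain ⟨a, b, M, hab, habr, hM0, hM⟩ := exists_Icc_forall_norm_sub_sub_le hφ
    (K := closedBall t₀ r) hr fun h hh => by
      obtain ⟨M, hM⟩ := (isCompact_closedBall t₀ r).exists_bound_of_continuousOn (hderiv h hh)
      exact ⟨M, fun s hs t ht => (convex_closedBall t₀ r).norm_image_sub_le_of_norm_deriv_le
        (hdiff h hh) hM hs ht⟩
  have hM' : ∀ h ∈ Icc a b, ∀ t ∈ ball t₀ r, ‖deriv (fun t => φ (t + h) - φ t) t‖ ≤ M := by
    intro h hh t ht
    refine norm_deriv_le_of_lip' hM0 ?_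
    filter_upwards [isOpen_ball.mem_nhds ht] with s hs
    exact hM h hh t (ball_subset_closedBall ht) s (ball_subset_closedBall hs)
  have hIoc : ∀ h ∈ Ι a b, h ∈ Icc a b := fun h hh =>
    Ioc_subset_Icc_self (by rwa [uIoc_of_le hab.le] at hh)
  have hmeas (t : ℝ) : StronglyMeasurable fun h => deriv (fun t => φ (t + h) - φ t) t :=
    (stronglyMeasurable_deriv_with_param (f := fun h t => φ (t + h) - φ t)
      (by simp only [Function.uncurry_def]; fun_prop)).comp_measurable
      (measurable_id.prodMk measurable_const)
  have hB : ∀ t ∈ ball t₀ r, HasDerivAt (fun t => ∫ h in a..b, (φ (t + h) - φ t))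
      (∫ h in a..b, deriv (fun t => φ (t + h) - φ t) t) t := fun t ht =>
    (intervalIntegral.hasDerivAt_integral_of_dominated_loc_of_deriv_le
      (F := fun t h => φ (t + h) - φ t)
      (F' := fun t h => deriv (fun t => φ (t + h) - φ t) t) (bound := fun _ => M)
      (isOpen_ball.mem_nhds ht)
      (.of_forall fun s => Continuous.aestronglyMeasurable (by fun_prop))
      (Continuous.intervalIntegrable (by fun_prop) _ _) (hmeas t).aestronglyMeasurable
      (.of_forall fun h hh s hs => hM' h (hIoc h hh) s hs) intervalIntegrable_const
      (.of_forall fun h hh s hs =>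
        (hdiff h (habr (hIoc h hh)) s (ball_subset_closedBall hs)).hasDerivAt)).2
  have hB' : ContinuousOn (fun t => ∫ h in a..b, deriv (fun t => φ (t + h) - φ t) t)
      (ball t₀ r) := fun t ht => by
    refine (intervalIntegral.continuousAt_of_dominated_interval (bound := fun _ => M)
      (.of_forall fun s => (hmeas s).aestronglyMeasurable) ?_ intervalIntegrable_const
      (.of_forall fun h hh => ?_)).continuousWithinAt
    · filter_upwards [isOpen_ball.mem_nhds ht] with s hs
      exact .of_forall fun h hh => hM' h (hIoc h hh) s hs
    · exact (hderiv h (habr (hIoc h hh))).continuousAt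
        (mem_of_superset (isOpen_ball.mem_nhds ht) ball_subset_closedBall)
  have hBC : ContDiffOn ℝ 1 (fun t => ∫ h in a..b, (φ (t + h) - φ t)) (ball t₀ r) := by
    rw [show (1 : WithTop ℕ∞) = 0 + 1 from rfl, contDiffOn_succ_iff_deriv_of_isOpen isOpen_ball]
    refine ⟨fun t ht => (hB t ht).differentiableAt.differentiableWithinAt, by simp, ?_⟩
    exact contDiffOn_zero.2 (hB'.congr fun t ht => (hB t ht).deriv)
  have key : φ = fun t => (b - a)⁻¹ •
      ((∫ h in a..b, φ (t + h)) - ∫ h in a..b, (φ (t + h) - φ t)) := by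
    ext t
    rw [intervalIntegral.integral_sub (Continuous.intervalIntegrable (by fun_prop) _ _)
      intervalIntegrable_const, sub_sub_cancel, intervalIntegral.integral_const,
      smul_smul, inv_mul_cancel₀ (sub_pos.2 hab).ne', one_smul]
  rw [key]
  exact ((contDiff_one_intervalIntegral_comp_add hφ a b).contDiffAt.sub
    (hBC.contDiffAt (ball_mem_nhds t₀ hr))).const_smul _

lemma contDiffOn_one_of_contDiffOn_sub [NormedSpace ℝ X] [CompleteSpace X] {φ : ℝ → X} {U : Set ℝ}
    (hU : IsOpen U) (hφ : ContinuousOn φ U) {ε : ℝ} (hε : 0 < ε)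
    (hc : ∀ h ∈ Ioc 0 ε, ContDiffOn ℝ 1 (fun t => φ (t + h) - φ t) {t ∈ U | t + h ∈ U}) :
    ContDiffOn ℝ 1 φ U := by
  intro t₀ ht₀
  obtain ⟨ρ, hρ, hρU⟩ := Metric.nhds_basis_closedBall.mem_iff.1 (hU.mem_nhds ht₀)
  obtain ⟨r, hr, hrρ, hrε⟩ : ∃ r > 0, 3 * r ≤ ρ ∧ r ≤ ε :=
    ⟨min (ρ / 3) ε, by positivity, by linarith [min_le_left (ρ / 3) ε], min_le_right _ _⟩
  rw [Real.closedBall_eq_Icc] at hρU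
  have hle : t₀ - ρ ≤ t₀ + ρ := by linarith
  have hmem : ∀ t ∈ ball t₀ (2 * r), t ∈ Icc (t₀ - ρ) (t₀ + ρ) := fun t ht => by
    rw [Real.ball_eq_Ioo] at ht
    exact ⟨by linarith [ht.1], by linarith [ht.2]⟩
  have hmem' : ∀ t ∈ ball t₀ (2 * r), ∀ h ∈ Ioo 0 r, t + h ∈ Icc (t₀ - ρ) (t₀ + ρ) := by
    intro t ht h hh
    rw [Real.ball_eq_Ioo] at ht
    exact ⟨by linarith [ht.1, hh.1], by linarith [ht.2, hh.2]⟩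
  have hext : Continuous (IccExtend hle ((Icc (t₀ - ρ) (t₀ + ρ)).domRestrict φ)) :=
    (hφ.mono hρU).domRestrict.Icc_extend'
  have hcont := contDiffAt_one_of_contDiffOn_sub hext hr (t₀ := t₀) fun h hh =>
    ((hc h ⟨hh.1, hh.2.le.trans hrε⟩).mono fun t ht =>
      ⟨hρU (hmem t ht), hρU (hmem' t ht h hh)⟩).congr fun t ht => by
        simp only [IccExtend_of_mem _ _ (hmem t ht), IccExtend_of_mem _ _ (hmem' t ht h hh),
          domRestrict_apply]
  refine (hcont.congr_of_eventuallyEq ?_).contDiffWithinAt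
  filter_upwards [ball_mem_nhds t₀ (by positivity : 0 < 2 * r)] with t ht
  rw [IccExtend_of_mem _ _ (hmem t ht), domRestrict_apply]

/-- On an open set, a locally integrable function whose small differences are `Cᵏ` is itself
`Cᵏ`. -/
lemma contDiffOn_of_isOpen_of_contDiffOn_sub [NormedSpace ℝ X] [CompleteSpace X] {U : Set ℝ}
    (hU : IsOpen U) {ε : ℝ} (hε : 0 < ε) (k : ℕ) {φ : ℝ → X} (hφ : LocallyIntegrableOn φ U)
    (hc : ∀ h ∈ Ioc 0 ε, ContDiffOn ℝ k (fun t => φ (t + h) - φ t) {t ∈ U | t + h ∈ U}) :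
    ContDiffOn ℝ k φ U := by
  have hcont : ContinuousOn φ U :=
    continuousOn_of_continuousOn_sub hU hφ hε fun h hh => (hc h hh).continuousOn
  induction k generalizing φ with
  | zero => exact contDiffOn_zero.2 hcont
  | succ k ih =>
    have h1 : ContDiffOn ℝ 1 φ U := contDiffOn_one_of_contDiffOn_sub hU hcont hε fun h hh =>
      (hc h hh).of_le (by exact_mod_cast Nat.le_add_left 1 k)
    have hd : ContinuousOn (deriv φ) U := h1.continuousOn_deriv_of_isOpen hU le_rfl
    have hdiff : ∀ t ∈ U, DifferentiableAt ℝ φ t := fun t ht =>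
      (h1.differentiableOn one_ne_zero).differentiableAt (hU.mem_nhds ht)
    rw [Nat.cast_add, Nat.cast_one, contDiffOn_succ_iff_deriv_of_isOpen hU]
    refine ⟨h1.differentiableOn one_ne_zero, by simp, ih
      (hd.locallyIntegrableOn hU.measurableSet) (fun h hh => ?_) hd⟩
    have hUh : IsOpen {t ∈ U | t + h ∈ U} :=
      hU.inter (hU.preimage (continuous_id.add continuous_const))
    have hch := hc h hh
    rw [Nat.cast_add, Nat.cast_one, contDiffOn_succ_iff_deriv_of_isOpen hUh] at hch
    refine hch.2.2.congr fun t ht => ?_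
    exact (((hdiff _ ht.2).hasDerivAt.comp_add_const t h).sub
      (hdiff t ht.1).hasDerivAt).deriv.symm

end Differences

/-- If `φ : I → X` is locally Bochner integrable on the interval `I` and for
every `h ∈ (0, ε₀]` the difference `Δ_h φ : t ↦ φ(t+h) − φ(t)` is `k`-times continuously
differentiable on `I⁻ʰ = {t ∈ I : t + h ∈ I}`, then `φ` is `k`-times continuously
differentiable on `I`. -/
theorem prop_1_5 {X : Type*} [NormedAddCommGroup X] [NormedSpace ℝ X] [CompleteSpace X]
    (I : Set ℝ) (hI : I.OrdConnected) (ε₀ : ℝ) (hε₀ : 0 < ε₀) (k : ℕ)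
    (φ : ℝ → X) (hφ : LocallyIntegrableOn φ I)
    (hΔ : ∀ h ∈ Set.Ioc (0 : ℝ) ε₀,
      ContDiffOn ℝ k (fun t => φ (t + h) - φ t) {t ∈ I | t + h ∈ I}) :
    ContDiffOn ℝ k φ I := by
  have hint : ContDiffOn ℝ k φ (interior I) :=
    contDiffOn_of_isOpen_of_contDiffOn_sub isOpen_interior hε₀ k (hφ.mono_set interior_subset)
      fun h hh => (hΔ h hh).mono fun t ht => ⟨interior_subset ht.1, interior_subset ht.2⟩
  have hIoo {s t : ℝ} (hs : s ∈ I) (ht : t ∈ I) : Ioo s t ⊆ interior I :=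
    interior_maximal (Ioo_subset_Icc_self.trans (hI.out hs ht)) isOpen_Ioo
  intro t ht
  rcases I.subsingleton_or_nontrivial with hsub | hnon
  · rw [hsub.eq_singleton_of_mem ht]
    exact contDiffWithinAt_singleton
  obtain ⟨s, hs, hst⟩ := hnon.exists_ne t
  rcases hst.lt_or_gt with hst | hst
  · obtain ⟨u, hu, hut⟩ := exists_between (max_lt hst (sub_lt_self t hε₀))
    obtain ⟨hsu, hεu⟩ := max_lt_iff.1 hu
    have huI : u ∈ interior I := hIoo hs ht ⟨hsu, hut⟩
    set h := t - u with hh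
    have htu : t - h = u := by simp [hh]
    have hnhds : ∀ᶠ x in 𝓝 t, x - h ∈ interior I :=
      (continuous_id.sub continuous_const).continuousAt.eventually_mem
        (isOpen_interior.mem_nhds (by simpa [htu] using huI))
    have hshift : ContDiffAt ℝ k (fun x : ℝ => x - h) t := contDiffAt_id.sub contDiffAt_const
    have h1 : ContDiffWithinAt ℝ k (fun x => φ (x - h)) I t :=
      (ContDiffAt.comp t (hint.contDiffAt (isOpen_interior.mem_nhds (htu ▸ huI)))
        hshift).contDiffWithinAt
    have h2 : ContDiffWithinAt ℝ k (fun x => φ (x - h + h) - φ (x - h)) I t := by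
      refine ContDiffWithinAt.comp_of_preimage_mem_nhdsWithin t (f := fun x : ℝ => x - h)
        (hΔ h ⟨sub_pos.2 hut, by linarith⟩ (t - h)
          ⟨interior_subset (htu ▸ huI), by simpa using ht⟩) hshift.contDiffWithinAt ?_
      filter_upwards [self_mem_nhdsWithin, nhdsWithin_le_nhds hnhds] with x hx hx'
      exact ⟨interior_subset hx', by simpa using hx⟩
    simpa using h1.add h2
  · obtain ⟨u, htu, hu⟩ := exists_between (lt_min hst (lt_add_of_pos_right t hε₀))
    obtain ⟨hus, huε⟩ := lt_min_iff.1 hu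
    have huI : u ∈ interior I := hIoo ht hs ⟨htu, hus⟩
    set h := u - t with hh
    have htu' : t + h = u := by simp [hh]
    have hnhds : ∀ᶠ x in 𝓝 t, x + h ∈ interior I :=
      (continuous_id.add continuous_const).continuousAt.eventually_mem
        (isOpen_interior.mem_nhds (by simpa [htu'] using huI))
    have h1 : ContDiffWithinAt ℝ k (fun x => φ (x + h)) I t :=
      (ContDiffAt.comp t (hint.contDiffAt (isOpen_interior.mem_nhds (htu'.symm ▸ huI)))
        (contDiffAt_id.add contDiffAt_const)).contDiffWithinAt
    have h2 : ContDiffWithinAt ℝ k (fun x => φ (x + h) - φ x) I t := by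
      refine (hΔ h ⟨sub_pos.2 htu, by linarith⟩ t
        ⟨ht, interior_subset (htu'.symm ▸ huI)⟩).mono_of_mem_nhdsWithin ?_
      filter_upwards [self_mem_nhdsWithin, nhdsWithin_le_nhds hnhds] with x hx hx'
      exact ⟨hx, interior_subset hx'⟩
    simpa using h1.sub h2
end

section
/- Let 𝕁 be an interval of the form ℝ, (α,∞) or [α,∞) with α ∈ ℝ, X a Banach space and ε₀ > 0. If φ ∈ L¹_loc(𝕁,X) and for every h ∈ (0, ε₀] the difference Δ_h φ is bounded and uniformly continuous on 𝕁, then φ is uniformly continuous on 𝕁. -/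
open MeasureTheory Set

open Filter Topology

/-- Translation is continuous in `L¹(ℝ)`; along a sequence of translations, a subsequence therefore
converges almost everywhere. -/
theorem exists_subseq_tendsto_translate_ae {X : Type*} [NormedAddCommGroup X] {f : ℝ → X}
    (hf : Integrable f) {t : ℕ → ℝ} {t₀ : ℝ} (ht : Tendsto t atTop (𝓝 t₀)) :
    ∃ ns : ℕ → ℕ, StrictMono ns ∧
      ∀ᵐ h : ℝ, Tendsto (fun i => f (t (ns i) + h)) atTop (𝓝 (f (t₀ + h))) := by
  have hf' : MemLp f 1 := memLp_one_iff_integrable.2 hf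
  have : Fact ((1 : ENNReal) ≠ ⊤) := ⟨ENNReal.one_ne_top⟩
  have hlim : Tendsto (fun n => DomAddAct.mk (t n) +ᵥ hf'.toLp f) atTop
      (𝓝 (DomAddAct.mk t₀ +ᵥ hf'.toLp f)) :=
    ((DomAddAct.continuous_mk.tendsto t₀).comp ht).vadd_const _
  obtain ⟨ns, hns, hae⟩ := (tendstoInMeasure_of_tendsto_Lp hlim).exists_seq_tendsto_ae
  have key : ∀ s : ℝ, (DomAddAct.mk s +ᵥ hf'.toLp f : Lp X 1 (volume : Measure ℝ))
      =ᵐ[volume] fun h => f (s + h) := fun s => by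
    rw [DomAddAct.mk_vadd_toLp]
    exact MemLp.coeFn_toLp _
  refine ⟨ns, hns, ?_⟩
  filter_upwards [hae, key t₀, ae_all_iff.2 fun n => key (t n)] with h h₁ h₂ h₃
  rw [h₂] at h₁
  exact h₁.congr fun i => h₃ (ns i)

/-- A locally integrable function on an upper set whose small differences are continuous is itself
continuous. -/
theorem continuousOn_of_continuousOn_differences {X : Type*} [NormedAddCommGroup X]
    {J : Set ℝ} (hJ : IsUpperSet J) {ε₀ : ℝ} (hε₀ : 0 < ε₀) {φ : ℝ → X}
    (hφ : LocallyIntegrableOn φ J)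
    (hΔ : ∀ h ∈ Ioc (0 : ℝ) ε₀, ContinuousOn (fun t => φ (t + h) - φ t) J) :
    ContinuousOn φ J := by
  intro t₀ ht₀
  refine tendsto_of_subseq_tendsto fun t ht => ?_
  have ht' : Tendsto t atTop (𝓝 t₀) := ht.mono_right nhdsWithin_le_nhds
  set K : Set ℝ := Icc (t₀ + ε₀ / 4) (t₀ + 2 * ε₀)
  have hK : K ⊆ J := fun x hx => hJ (by linarith [hx.1] : t₀ ≤ x) ht₀
  have hint : Integrable (K.indicator φ) :=
    (hφ.integrableOn_compact_subset hK isCompact_Icc).integrable_indicator measurableSet_Icc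
  obtain ⟨ns, hns, hae⟩ := exists_subseq_tendsto_translate_ae hint ht'
  have hpos : (volume : Measure ℝ) (Ioo (ε₀ / 2) ε₀) ≠ 0 := by
    rw [Real.volume_Ioo]
    simpa using hε₀
  obtain ⟨h, hh, hlim⟩ := nonempty_of_measure_ne_zero
    ((measure_inter_conull (s := Ioo (ε₀ / 2) ε₀) hae).trans_ne hpos)
  refine ⟨ns, ?_⟩
  have ht₁ : Tendsto (fun i => t (ns i)) atTop (𝓝[J] t₀) := ht.comp hns.tendsto_atTop
  have hφh : Tendsto (fun i => φ (t (ns i) + h)) atTop (𝓝 (φ (t₀ + h))) := by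
    have hlim' : Tendsto (fun i => K.indicator φ (t (ns i) + h)) atTop
      (𝓝 (K.indicator φ (t₀ + h))) := hlim
    rw [indicator_of_mem (show t₀ + h ∈ K from ⟨by linarith [hh.1], by linarith [hh.2]⟩)] at hlim'
    refine hlim'.congr' ?_
    filter_upwards [(ht₁.mono_right nhdsWithin_le_nhds) (Ioo_mem_nhds
      (by linarith : t₀ - ε₀ / 4 < t₀) (by linarith : t₀ < t₀ + ε₀))] with i hi
    exact indicator_of_mem (show t (ns i) + h ∈ K from
      ⟨by linarith [hh.1, hi.1], by linarith [hh.2, hi.2]⟩) _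
  have hdiff := (hΔ h ⟨by linarith [hh.1], hh.2.le⟩ t₀ ht₀).tendsto.comp ht₁
  simpa using hφh.sub hdiff

/-- If `f (h + s) - f h` is `ε`-close to `c` for all `h ∈ [a, b]`, then averaging over `h` bounds
`c` in terms of a bound for the difference of `f` with step `b - a`. -/
theorem norm_mul_le_of_norm_difference_sub_le {X : Type*} [NormedAddCommGroup X] [NormedSpace ℝ X]
    [CompleteSpace X] {f : ℝ → X} (hf : ContinuousOn f (Ici 0)) {a b s ε C : ℝ} {c : X}
    (ha : 0 ≤ a) (hab : a ≤ b) (hs : 0 ≤ s)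
    (hc : ∀ h ∈ Icc a b, ‖f (h + s) - f h - c‖ ≤ ε)
    (hC : ∀ u, 0 ≤ u → ‖f (u + (b - a)) - f u‖ ≤ C) :
    ‖c‖ * (b - a) ≤ ε * (b - a) + C * s := by
  have hint : ∀ x y : ℝ, 0 ≤ x → 0 ≤ y → IntervalIntegrable f volume x y := fun x y hx hy =>
    (hf.mono fun u hu => (le_min hx hy).trans hu.1).intervalIntegrable
  have hshift : ∀ r x y : ℝ, 0 ≤ r → 0 ≤ x → 0 ≤ y →
      IntervalIntegrable (fun u => f (u + r)) volume x y := fun r x y hr hx hy => by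
    refine ContinuousOn.intervalIntegrable (hf.comp (by fun_prop) fun u hu => ?_)
    exact add_nonneg ((le_min hx hy).trans hu.1) hr
  have hb : 0 ≤ b := ha.trans hab
  have h₁ : ‖∫ h in a..b, (f (h + s) - f h - c)‖ ≤ ε * (b - a) := by
    have := intervalIntegral.norm_integral_le_of_norm_le_const (a := a) (b := b)
      (f := fun h => f (h + s) - f h - c) (C := ε) fun h hh => by
        rw [uIoc_of_le hab] at hh
        exact hc h ⟨hh.1.le, hh.2⟩
    rwa [abs_of_nonneg (sub_nonneg.2 hab)] at this
  have h₂ : ‖∫ u in a..a + s, (f (u + (b - a)) - f u)‖ ≤ C * s := by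
    have := intervalIntegral.norm_integral_le_of_norm_le_const (a := a) (b := a + s)
      (f := fun u => f (u + (b - a)) - f u) (C := C) fun u hu => by
        rw [uIoc_of_le (by linarith)] at hu
        exact hC u (ha.trans hu.1.le)
    rwa [add_sub_cancel_left, abs_of_nonneg hs] at this
  have h₃ : ∫ h in a..b, (f (h + s) - f h - c)
      = (∫ u in a..a + s, (f (u + (b - a)) - f u)) - (b - a) • c := by
    rw [intervalIntegral.integral_sub ((hshift s a b hs ha hb).sub (hint a b ha hb))
        intervalIntegrable_const,
      intervalIntegral.integral_sub (hshift s a b hs ha hb) (hint a b ha hb),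
      intervalIntegral.integral_sub (hshift (b - a) a (a + s) (by linarith) ha (by linarith))
        (hint a (a + s) ha (by linarith)),
      intervalIntegral.integral_const, intervalIntegral.integral_comp_add_right,
      intervalIntegral.integral_comp_add_right,
      intervalIntegral.integral_interval_sub_interval_comm
        (hint _ _ (by linarith) (by linarith)) (hint _ _ ha hb) (hint _ _ (by linarith) ha),
      intervalIntegral.integral_symm a (a + s), intervalIntegral.integral_symm b (b + s),
      show a + (b - a) = b by ring, show a + s + (b - a) = b + s by ring]
    abel
  rw [h₃] at h₁
  calc ‖c‖ * (b - a) = ‖(b - a) • c‖ := by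
        rw [norm_smul, Real.norm_of_nonneg (sub_nonneg.2 hab), mul_comm]
    _ ≤ ‖(∫ u in a..a + s, (f (u + (b - a)) - f u)) - (b - a) • c‖
        + ‖∫ u in a..a + s, (f (u + (b - a)) - f u)‖ := by
        rw [add_comm]
        exact norm_le_norm_add_norm_sub _ _
    _ ≤ ε * (b - a) + C * s := add_le_add h₁ h₂

/-- By the Baire category theorem, the moduli of uniform continuity of the differences can be chosen uniformly
on some interval of steps. -/
theorem exists_Icc_uniform_modulus_differences {X : Type*} [NormedAddCommGroup X]
    {J : Set ℝ} (hJ : IsUpperSet J) {ε₀ : ℝ} (hε₀ : 0 < ε₀) {φ : ℝ → X} (hφ : ContinuousOn φ J)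
    (hΔ : ∀ h ∈ Ioc (0 : ℝ) ε₀, UniformContinuousOn (fun t => φ (t + h) - φ t) J)
    {ε : ℝ} (hε : 0 < ε) :
    ∃ a b δ : ℝ, 0 < a ∧ a < b ∧ b ≤ ε₀ ∧ 0 < δ ∧ ∀ h ∈ Icc a b, ∀ t ∈ J, ∀ s ∈ Icc 0 δ,
      ‖φ (t + (h + s)) - φ (t + h) - (φ (t + s) - φ t)‖ ≤ ε := by
  set p : ℝ → ℝ := fun h => max (ε₀ / 2) (min h ε₀) with hp
  have hp_cont : Continuous p := by fun_prop
  have hp_pos : ∀ h, 0 < p h := fun h => (half_pos hε₀).trans_le (le_max_left _ _)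
  have hp_le : ∀ h, p h ≤ ε₀ := fun h => max_le (by linarith) (min_le_right _ _)
  set A : ℕ → Set ℝ := fun n => {h | ∀ t ∈ J, ∀ s ∈ Icc (0 : ℝ) (1 / (n + 1)),
    ‖φ (t + (p h + s)) - φ (t + p h) - (φ (t + s) - φ t)‖ ≤ ε} with hA
  have hcont : ∀ t ∈ J, ∀ s, 0 ≤ s → Continuous fun h => φ (t + (p h + s)) := fun t ht s hs =>
    hφ.comp_continuous (by fun_prop) fun h => hJ (by linarith [hp_pos h]) ht
  have hclosed : ∀ n, IsClosed (A n) := fun n => by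
    simp only [hA, ofPred_forall]
    refine isClosed_iInter fun t => isClosed_iInter fun ht => isClosed_iInter fun s =>
      isClosed_iInter fun hs => isClosed_le ?_ continuous_const
    have := hcont t ht 0 le_rfl
    simp only [add_zero] at this
    exact (((hcont t ht s hs.1).sub this).sub continuous_const).norm
  have hcover : ⋃ n, A n = univ := by
    refine eq_univ_of_forall fun h => mem_iUnion.2 ?_
    obtain ⟨δ, hδ, H⟩ := Metric.uniformContinuousOn_iff.1 (hΔ (p h) ⟨hp_pos h, hp_le h⟩) ε hε
    obtain ⟨n, hn⟩ := exists_nat_one_div_lt hδ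
    refine ⟨n, fun t ht s hs => ?_⟩
    have := H (t + s) (hJ (by linarith [hs.1]) ht) t ht (by
      rw [Real.dist_eq, add_sub_cancel_left, abs_of_nonneg hs.1]
      exact hs.2.trans_lt hn)
    rw [dist_eq_norm] at this
    rw [show t + (p h + s) = t + s + p h by ring, sub_sub_sub_comm]
    exact this.le
  obtain ⟨x, hx, hxA⟩ := (dense_iUnion_interior_of_closed hclosed hcover).inter_open_nonempty
    (Ioo (ε₀ / 2) ε₀) isOpen_Ioo (nonempty_Ioo.2 (by linarith))
  obtain ⟨n, hn⟩ := mem_iUnion.1 hxA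
  obtain ⟨r, hr, hball⟩ := Metric.isOpen_iff.1 (isOpen_interior.inter isOpen_Ioo) x ⟨hn, hx⟩
  have hIcc : ∀ h ∈ Icc x (x + r / 2), h ∈ A n ∧ h ∈ Ioo (ε₀ / 2) ε₀ := fun h hh => by
    have := hball (show h ∈ Metric.ball x r by
      rw [Metric.mem_ball, Real.dist_eq, abs_of_nonneg (by linarith [hh.1])]
      linarith [hh.2])
    exact ⟨interior_subset this.1, this.2⟩
  refine ⟨x, x + r / 2, 1 / (n + 1), by linarith [hx.1], by linarith,
    (hIcc _ (right_mem_Icc.2 (by linarith))).2.2.le, by positivity, fun h hh t ht s hs => ?_⟩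
  obtain ⟨h₁, h₂⟩ := hIcc h hh
  have hph : p h = h := by rw [hp]; simp [h₂.1.le, h₂.2.le]
  simpa only [hph] using h₁ t ht s hs

/-- If `φ ∈ L¹_loc(𝕁,X)` and for every `h ∈ (0, ε₀]` the difference
`Δ_h φ` is bounded and uniformly continuous on `𝕁`, then `φ` is uniformly continuous
on `𝕁`. Here `𝕁` is an interval of the form `ℝ`, `(α,∞)` or `[α,∞)`. -/
theorem prop_1_7_i {X : Type*} [NormedAddCommGroup X] [NormedSpace ℝ X] [CompleteSpace X]
    (J : Set ℝ)
    (hJ : J = Set.univ ∨ (∃ α : ℝ, J = Set.Ioi α) ∨ (∃ α : ℝ, J = Set.Ici α))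
    (ε₀ : ℝ) (hε₀ : 0 < ε₀)
    (φ : ℝ → X) (hφ : LocallyIntegrableOn φ J)
    (hΔ : ∀ h ∈ Set.Ioc (0 : ℝ) ε₀,
      UniformContinuousOn (fun t => φ (t + h) - φ t) J ∧
        ∃ C : ℝ, ∀ t ∈ J, ‖φ (t + h) - φ t‖ ≤ C) :
    UniformContinuousOn φ J := by
  have hJ' : IsUpperSet J := by
    rcases hJ with rfl | ⟨α, rfl⟩ | ⟨α, rfl⟩
    exacts [isUpperSet_univ, isUpperSet_Ioi α, isUpperSet_Ici α]
  have hcont : ContinuousOn φ J :=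
    continuousOn_of_continuousOn_differences hJ' hε₀ hφ fun h hh => (hΔ h hh).1.continuousOn
  refine Metric.uniformContinuousOn_iff.2 fun ε hε => ?_
  obtain ⟨a, b, δ, ha, hab, hb, hδ, H⟩ := exists_Icc_uniform_modulus_differences hJ' hε₀ hcont
    (fun h hh => (hΔ h hh).1) (half_pos hε)
  obtain ⟨C, hC⟩ := (hΔ (b - a) ⟨sub_pos.2 hab, by linarith⟩).2
  have hC' : 0 < |C| + 1 := by positivity
  have hba : 0 < b - a := sub_pos.2 hab
  set η : ℝ := ε / 2 * (b - a) / (|C| + 1)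
  have hη : 0 < η := by positivity
  have step : ∀ t ∈ J, ∀ s, 0 ≤ s → s < min δ η → ‖φ (t + s) - φ t‖ < ε := by
    intro t ht s hs hsδ
    have hf : ContinuousOn (fun u => φ (t + u)) (Ici 0) :=
      hcont.comp (by fun_prop) fun u hu => hJ' (le_add_of_nonneg_right hu) ht
    have hmul := norm_mul_le_of_norm_difference_sub_le hf (C := |C| + 1) ha.le hab.le hs
      (fun h hh => H h hh t ht s ⟨hs, (hsδ.trans_le (min_le_left _ _)).le⟩)
      (fun u hu => by
        have := hC (t + u) (hJ' (le_add_of_nonneg_right hu) ht)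
        rw [add_assoc] at this
        linarith [le_abs_self C])
    have hlt : s * (|C| + 1) < ε / 2 * (b - a) :=
      (lt_div_iff₀ hC').1 (hsδ.trans_le (min_le_right _ _))
    exact lt_of_mul_lt_mul_right (by linarith) hba.le
  refine ⟨min δ η, lt_min hδ hη, fun x hx y hy hxy => ?_⟩
  rw [Real.dist_eq] at hxy
  rcases le_total x y with h | h
  · have := step x hx (y - x) (sub_nonneg.2 h) (by
      rwa [abs_sub_comm, abs_of_nonneg (by linarith)] at hxy)
    rwa [add_sub_cancel, ← dist_eq_norm, dist_comm] at this
  · have := step y hy (x - y) (sub_nonneg.2 h) (by rwa [abs_of_nonneg (by linarith)] at hxy)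
    rwa [add_sub_cancel, ← dist_eq_norm] at this
end

section
/- Let 𝕁 be an interval of the form ℝ, (α,∞) or [α,∞), X a Banach space, and let 𝒜 ⊆ C_u(𝕁,X) be convex, positive-invariant and uniformly closed. Then 𝒜 ⊆ M𝒜, i.e. for every f ∈ 𝒜 and every h > 0 the mean M_h f belongs to 𝒜. -/
open MeasureTheory Set Filter

/-- The mean `M_h φ(t) = (1/h) ∫₀^h φ(t+s) ds`. -/
noncomputable def meanM {X : Type*} [NormedAddCommGroup X] [NormedSpace ℝ X]
    (h : ℝ) (φ : ℝ → X) : ℝ → X :=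
  fun t => (1 / h) • ∫ s in (0 : ℝ)..h, φ (t + s)

/-- The mean class `M𝒜 = {φ ∈ L¹_loc(𝕁,X) : M_h φ ∈ 𝒜 for all h > 0}`. -/
def meanClass {X : Type*} [NormedAddCommGroup X] [NormedSpace ℝ X]
    (J : Set ℝ) (A : Set (ℝ → X)) : Set (ℝ → X) :=
  {φ | LocallyIntegrableOn φ J ∧ ∀ h : ℝ, 0 < h → meanM h φ ∈ A}

/-- The left Riemann sum with `n` equal steps approximates the mean over `[0, h]` of a function
that oscillates by at most `ε` on each step. -/
theorem norm_mean_sub_sum_le {X : Type*} [NormedAddCommGroup X] [NormedSpace ℝ X] [CompleteSpace X]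
    {g : ℝ → X} {h ε : ℝ} (hh : 0 < h) {n : ℕ} (hn : 0 < n) (hg : ContinuousOn g (Ici 0))
    (hosc : ∀ x y : ℝ, 0 ≤ x → x ≤ y → y ≤ x + h / n → ‖g y - g x‖ ≤ ε) :
    ‖(1 / h) • (∫ s in (0 : ℝ)..h, g s) -
      ∑ k ∈ Finset.range n, (1 / n : ℝ) • g (k * (h / n))‖ ≤ ε := by
  have hn' : (0 : ℝ) < n := by exact_mod_cast hn
  set d : ℝ := h / n with hd
  have hd0 : 0 < d := by positivity
  have hnd : (n : ℝ) * d = h := by rw [hd]; field_simp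
  have hint : ∀ k : ℕ, IntervalIntegrable g volume (k * d) ((k + 1 : ℕ) * d) := by
    intro k
    refine (hg.mono fun x hx => ?_).intervalIntegrable
    have hle : (k : ℝ) * d ≤ ((k + 1 : ℕ) : ℝ) * d := by push_cast; nlinarith
    rw [uIcc_of_le hle] at hx
    exact le_trans (by positivity) hx.1
  have hsplit : (∫ s in (0 : ℝ)..h, g s) =
      ∑ k ∈ Finset.range n, ∫ s in (k * d)..((k + 1 : ℕ) * d), g s := by
    have := intervalIntegral.sum_integral_adjacent_intervals
      (a := fun k : ℕ => (k : ℝ) * d) (n := n) (fun k _ => hint k)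
    simp only [hnd, Nat.cast_zero, zero_mul] at this
    exact this.symm
  have hstep : ∀ k ∈ Finset.range n,
      ‖(∫ s in (k * d)..((k + 1 : ℕ) * d), g s) - d • g (k * d)‖ ≤ ε * d := by
    intro k _
    have hlen : ((k + 1 : ℕ) : ℝ) * d - k * d = d := by push_cast; ring
    have hle : (k : ℝ) * d ≤ ((k + 1 : ℕ) : ℝ) * d := by linarith
    have hconst : d • g (k * d) = ∫ _ in (k * d)..((k + 1 : ℕ) * d), g (k * d) := by
      rw [intervalIntegral.integral_const, hlen]
    rw [hconst, ← intervalIntegral.integral_sub (hint k) intervalIntegrable_const]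
    refine (intervalIntegral.norm_integral_le_of_norm_le_const (C := ε) fun x hx => ?_).trans ?_
    · rw [uIoc_of_le hle] at hx
      exact hosc _ _ (by positivity) hx.1.le (by linarith [hx.2])
    · rw [hlen, abs_of_pos hd0]
  have hsum : (1 / h) • (∫ s in (0 : ℝ)..h, g s) -
      ∑ k ∈ Finset.range n, (1 / n : ℝ) • g (k * d) =
      (1 / h) • ∑ k ∈ Finset.range n,
        ((∫ s in (k * d)..((k + 1 : ℕ) * d), g s) - d • g (k * d)) := by
    rw [Finset.sum_sub_distrib, smul_sub, ← hsplit, ← Finset.smul_sum, ← Finset.smul_sum,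
      smul_smul]
    congr 2
    rw [hd]
    field_simp
  rw [hsum, norm_smul, Real.norm_of_nonneg (by positivity)]
  calc 1 / h * ‖_‖ ≤ 1 / h * (n * (ε * d)) := by
        gcongr
        simpa using norm_sum_le_of_le _ hstep
    _ = ε := by rw [← hnd]; field_simp

/-- If `𝒜 ⊆ C_u(𝕁,X)` is convex, positive-invariant and uniformly
closed, then `𝒜 ⊆ M𝒜`. -/
theorem cor_3_3 {X : Type*} [NormedAddCommGroup X] [NormedSpace ℝ X] [CompleteSpace X]
    (J : Set ℝ)
    (hJ : J = Set.univ ∨ (∃ α : ℝ, J = Set.Ioi α) ∨ (∃ α : ℝ, J = Set.Ici α))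
    (A : Set (ℝ → X))
    (hACu : ∀ f ∈ A, UniformContinuousOn f J)
    (hconv : ∀ f ∈ A, ∀ g ∈ A, ∀ s t : ℝ, 0 ≤ s → 0 ≤ t → s + t = 1 →
      (fun x => s • f x + t • g x) ∈ A)
    (hinv : ∀ f ∈ A, ∀ a : ℝ, 0 ≤ a → (fun t => f (t + a)) ∈ A)
    (hclosed : ∀ (F : ℕ → ℝ → X) (f : ℝ → X), (∀ n, F n ∈ A) →
      TendstoUniformlyOn F f atTop J → f ∈ A) :
    A ⊆ meanClass J A := by
  have hJadd : ∀ t ∈ J, ∀ a : ℝ, 0 ≤ a → t + a ∈ J := by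
    intro t ht a ha
    rcases hJ with rfl | ⟨α, rfl⟩ | ⟨α, rfl⟩
    · trivial
    · exact lt_add_of_lt_of_nonneg ht ha
    · exact le_add_of_le_of_nonneg ht ha
  have hJmeas : MeasurableSet J := by
    rcases hJ with rfl | ⟨α, rfl⟩ | ⟨α, rfl⟩
    exacts [MeasurableSet.univ, measurableSet_Ioi, measurableSet_Ici]
  have hA : Convex ℝ A := fun f hf g hg s t hs ht hst => hconv f hf g hg s t hs ht hst
  intro f hf
  have hfu := hACu f hf
  refine ⟨hfu.continuousOn.locallyIntegrableOn hJmeas, fun h hh => ?_⟩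
  refine hclosed (fun n => ∑ k ∈ Finset.range (n + 1),
    (1 / (n + 1 : ℕ) : ℝ) • fun t => f (t + k * (h / (n + 1 : ℕ)))) _ (fun n => ?_) ?_
  · refine hA.sum_mem (fun _ _ => by positivity) ?_ fun k _ => hinv f hf _ (by positivity)
    rw [Finset.sum_const, Finset.card_range, nsmul_eq_mul]
    field_simp
  · rw [Metric.tendstoUniformlyOn_iff]
    intro ε hε
    obtain ⟨δ, hδ, hfδ⟩ := Metric.uniformContinuousOn_iff.1 hfu (ε / 2) (half_pos hε)
    have hlim : Tendsto (fun n : ℕ => h / ((n + 1 : ℕ) : ℝ)) atTop (nhds 0) :=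
      (tendsto_const_div_atTop_nhds_zero_nat h).comp (tendsto_add_atTop_nat 1)
    filter_upwards [hlim.eventually (gt_mem_nhds hδ)] with n hn t ht
    have hg : ContinuousOn (fun s => f (t + s)) (Ici 0) :=
      hfu.continuousOn.comp (by fun_prop) fun s hs => hJadd t ht s hs
    have key := norm_mean_sub_sum_le (ε := ε / 2) hh n.succ_pos hg fun x y hx hxy hy => by
      rw [← dist_eq_norm]
      refine (hfδ _ (hJadd t ht y (hx.trans hxy)) _ (hJadd t ht x hx) ?_).le
      rw [dist_add_left, Real.dist_eq, abs_of_nonneg (sub_nonneg.2 hxy)]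
      exact lt_of_le_of_lt (by linarith) hn
    rw [dist_eq_norm]
    refine lt_of_le_of_lt ?_ (half_lt_self hε)
    simpa only [meanM, Finset.sum_apply, Pi.smul_apply] using key
end

section
/- Let 𝕁 be an interval of the form ℝ, (α,∞) or [α,∞), X a nonzero complex Banach space, and let 𝒜 ⊆ C_u(𝕁,X) be real-linear and positive-invariant with AP(𝕁,X) ⊆ 𝒜 ⊆ M𝒜. Then for every n ∈ ℕ the inclusion M^{n−1}𝒜 ⊆ M^{n}𝒜 is strict; in particular all inclusions in the chain 𝒜 ⊆ M𝒜 ⊆ M²𝒜 ⊆ … are strict. -/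
open MeasureTheory Set Filter

/-- Iterated mean classes: `M⁰𝒜 = 𝒜 ∩ L¹_loc`, `M^{k+1}𝒜 = M(M^k𝒜)`. -/
def meanClassIter {X : Type*} [NormedAddCommGroup X] [NormedSpace ℝ X]
    (J : Set ℝ) (A : Set (ℝ → X)) : ℕ → Set (ℝ → X)
  | 0 => A ∩ {φ | LocallyIntegrableOn φ J}
  | n + 1 => meanClass J (meanClassIter J A n)

/-- Trigonometric polynomials `t ↦ Σ_j e^{iω_j t} • a_j`. -/
def TrigPolySet (X : Type*) [NormedAddCommGroup X] [Module ℂ X] : Set (ℝ → X) :=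
  {f | ∃ (N : ℕ) (ω : Fin N → ℝ) (a : Fin N → X),
    f = fun t : ℝ => ∑ j, Complex.exp (Complex.I * (ω j : ℂ) * (t : ℂ)) • a j}

/-- `AP(ℝ,X)`: uniform limits on `ℝ` of trigonometric polynomials. -/
def APR (X : Type*) [NormedAddCommGroup X] [Module ℂ X] : Set (ℝ → X) :=
  {f | ∃ π : ℕ → ℝ → X, (∀ n, π n ∈ TrigPolySet X) ∧ TendstoUniformly π f atTop}

/-- `AP(𝕁,X) := AP(ℝ,X)|_𝕁`: functions agreeing on `𝕁` with a Bohr ap function. -/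
def APJ {X : Type*} [NormedAddCommGroup X] [Module ℂ X] (J : Set ℝ) : Set (ℝ → X) :=
  {f | ∃ g ∈ APR X, ∀ t ∈ J, f t = g t}

open scoped ContDiff Topology

section DifferenceQuotient

variable {X : Type*} [NormedAddCommGroup X] [NormedSpace ℝ X]

/-- The forward difference quotient `t ↦ (1/h) (f(t+h) - f(t))`. -/
noncomputable def diffQuot (h : ℝ) (f : ℝ → X) : ℝ → X :=
  fun t => (1 / h) • (f (t + h) - f t)

lemma ContDiff.diffQuot {f : ℝ → X} (hf : ContDiff ℝ ∞ f) (h : ℝ) :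
    ContDiff ℝ ∞ (diffQuot h f) :=
  ((hf.comp (contDiff_id.add contDiff_const)).sub hf).const_smul (1 / h)

lemma iteratedDeriv_diffQuot {f : ℝ → X} (hf : ContDiff ℝ ∞ f) (k : ℕ) (h : ℝ) :
    iteratedDeriv k (diffQuot h f) = diffQuot h (iteratedDeriv k f) := by
  have hk : ContDiff ℝ k f := hf.of_le (by exact_mod_cast le_top)
  have hk' : ContDiff ℝ k (fun t => f (t + h)) := hk.comp (contDiff_id.add contDiff_const)
  funext t
  unfold diffQuot
  rw [iteratedDeriv_fun_const_smul (hk'.sub hk).contDiffAt,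
    iteratedDeriv_fun_sub hk'.contDiffAt hk.contDiffAt, iteratedDeriv_comp_add_const]

/-- The mean of a derivative is a difference quotient. -/
lemma meanM_iteratedDeriv_succ [CompleteSpace X] {f : ℝ → X} (hf : ContDiff ℝ ∞ f) (k : ℕ)
    (h : ℝ) :
    meanM h (iteratedDeriv (k + 1) f) = iteratedDeriv k (diffQuot h f) := by
  rw [iteratedDeriv_diffQuot hf]
  funext t
  have hd : Differentiable ℝ (iteratedDeriv k f) :=
    hf.differentiable_iteratedDeriv k (by exact_mod_cast ENat.natCast_lt_top k)
  have hc : Continuous (iteratedDeriv (k + 1) f) :=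
    hf.continuous_iteratedDeriv (k + 1) (by exact_mod_cast le_top)
  unfold meanM diffQuot
  rw [intervalIntegral.integral_comp_add_left (fun s => iteratedDeriv (k + 1) f s) t,
    intervalIntegral.integral_eq_sub_of_hasDerivAt (f := iteratedDeriv k f)
      (fun x _ => by rw [iteratedDeriv_succ]; exact (hd x).hasDerivAt)
      (hc.intervalIntegrable _ _), add_zero]

/-- If `f` vanishes at `t + h, …, t + n h`, the `n`-fold difference quotient at `t` only sees
`f t`. -/
lemma diffQuot_iterate_apply (h : ℝ) (n : ℕ) (f : ℝ → X) (t : ℝ)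
    (hf : ∀ j : ℕ, 1 ≤ j → j ≤ n → f (t + j * h) = 0) :
    (diffQuot h)^[n] f t = (-(1 / h)) ^ n • f t := by
  induction n generalizing f with
  | zero => simp
  | succ n ih =>
    rw [Function.iterate_succ_apply, ih]
    · have h1 := hf 1 le_rfl (by omega)
      rw [Nat.cast_one, one_mul] at h1
      simp only [diffQuot, h1, zero_sub, smul_neg, pow_succ, mul_smul, neg_smul]
    · intro j hj hjn
      have h1 := hf j hj (by omega)
      have h2 := hf (j + 1) (by omega) (by omega)
      have h3 : t + j * h + h = t + (j + 1 : ℕ) * h := by push_cast; ring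
      simp only [diffQuot, h3, h1, h2, sub_zero, smul_zero]

end DifferenceQuotient

section MeanClass

variable {X : Type*} [NormedAddCommGroup X] [NormedSpace ℝ X] {J : Set ℝ} {A : Set (ℝ → X)}

lemma meanClassIter_subset_succ (hMA : A ⊆ meanClass J A) (n : ℕ) :
    meanClassIter J A n ⊆ meanClassIter J A (n + 1) := by
  induction n with
  | zero =>
    exact fun f hf => ⟨hf.2, fun h hh => ⟨(hMA hf.1).2 h hh, (hMA ((hMA hf.1).2 h hh)).1⟩⟩
  | succ n ih => exact fun f hf => ⟨hf.1, fun h hh => ih (hf.2 h hh)⟩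

/-- Derivatives of order `k` of smooth elements of `A` belong to `M^k A`. -/
lemma iteratedDeriv_mem_meanClassIter [CompleteSpace X]
    (hA : ∀ f ∈ A, ∀ h : ℝ, 0 < h → diffQuot h f ∈ A) (k : ℕ) {f : ℝ → X}
    (hf : ContDiff ℝ ∞ f) (hfA : f ∈ A) : iteratedDeriv k f ∈ meanClassIter J A k := by
  induction k generalizing f with
  | zero =>
    rw [iteratedDeriv_zero]
    exact ⟨hfA, hf.continuous.locallyIntegrable.locallyIntegrableOn J⟩
  | succ k ih =>
    refine ⟨(hf.continuous_iteratedDeriv (k + 1)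
      (by exact_mod_cast le_top)).locallyIntegrable.locallyIntegrableOn J, fun h hh => ?_⟩
    rw [meanM_iteratedDeriv_succ hf]
    exact ih (hf.diffQuot h) (hA f hfA h hh)

lemma diffQuot_iterate_mem [CompleteSpace X] {h : ℝ} (hh : 0 < h) (k : ℕ) {f : ℝ → X}
    (hf : ContDiff ℝ ∞ f) (hfA : iteratedDeriv k f ∈ meanClassIter J A k) :
    (diffQuot h)^[k] f ∈ A := by
  induction k generalizing f with
  | zero => simpa using hfA.1
  | succ k ih =>
    rw [Function.iterate_succ_apply]
    refine ih (hf.diffQuot h) ?_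
    rw [← meanM_iteratedDeriv_succ hf]
    exact hfA.2 h hh

end MeanClass

/-- Continuous periodic real functions times a vector are uniform limits of trigonometric
polynomials. -/
lemma Function.Periodic.exists_trigPoly_near {X : Type*} [NormedAddCommGroup X] [NormedSpace ℝ X]
    [NormedSpace ℂ X] [IsScalarTower ℝ ℂ X] {T : ℝ} (hT : 0 < T) {g : ℝ → ℝ}
    (hg : Function.Periodic g T) (hc : Continuous g) (x₀ : X) {ε : ℝ} (hε : 0 < ε) :
    ∃ p ∈ TrigPolySet X, ∀ t, ‖g t • x₀ - p t‖ < ε := by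
  have : Fact (0 < T) := ⟨hT⟩
  let G : C(AddCircle T, ℂ) :=
    ⟨fun x => ((hg.lift x : ℝ) : ℂ), Complex.continuous_ofReal.comp
      (continuous_coinduced_dom.mpr hc)⟩
  have hmem : G ∈ closure (Submodule.span ℂ (Set.range (fourier (T := T))) :
      Set C(AddCircle T, ℂ)) := by
    rw [← Submodule.topologicalClosure_coe, span_fourier_closure_eq_top]
    trivial
  have hδ : 0 < ε / (‖x₀‖ + 1) := by positivity
  obtain ⟨P, hP, hGP⟩ := Metric.mem_closure_iff.mp hmem _ hδ
  obtain ⟨c, rfl⟩ := Finsupp.mem_span_range_iff_exists_finsupp.mp hP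
  rw [dist_eq_norm, ContinuousMap.norm_lt_iff _ hδ] at hGP
  let e := c.support.equivFin.symm
  refine ⟨_, ⟨c.support.card, fun j => 2 * Real.pi * (e j : ℤ) / T, fun j => c (e j) • x₀, rfl⟩,
    fun t => ?_⟩
  have hsum : ∑ j, Complex.exp (Complex.I * ((2 * Real.pi * (e j : ℤ) / T : ℝ) : ℂ) * (t : ℂ)) •
      c (e j) • x₀ = ((c.sum fun i a => a • fourier (T := T) i) (t : AddCircle T)) • x₀ := by
    rw [Finsupp.sum, ContinuousMap.sum_apply, Finset.sum_smul,
      ← Finset.sum_coe_sort c.support, ← e.sum_comp]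
    refine Finset.sum_congr rfl fun j _ => ?_
    rw [ContinuousMap.smul_apply, fourier_coe_apply, smul_smul, smul_eq_mul, mul_comm]
    congr 3
    push_cast
    ring
  have hGt : G (t : AddCircle T) • x₀ = g t • x₀ := by
    change ((g t : ℝ) : ℂ) • x₀ = g t • x₀
    exact algebraMap_smul ℂ (g t) x₀
  rw [hsum, ← hGt, ← sub_smul, norm_smul]
  calc _ ≤ ε / (‖x₀‖ + 1) * ‖x₀‖ :=
        mul_le_mul_of_nonneg_right (hGP (t : AddCircle T)).le (norm_nonneg _)
    _ < ε := by
      rw [div_mul_eq_mul_div, div_lt_iff₀ (by positivity)]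
      nlinarith [norm_nonneg x₀]

lemma mem_APR_of_forall_exists_near {X : Type*} [NormedAddCommGroup X] [NormedSpace ℂ X]
    {f : ℝ → X} (hf : ∀ ε > 0, ∃ p ∈ TrigPolySet X, ∀ t, ‖f t - p t‖ < ε) : f ∈ APR X := by
  choose! p hp hfp using hf
  refine ⟨fun n => p (1 / (n + 1)), fun n => hp _ (by positivity), ?_⟩
  rw [Metric.tendstoUniformly_iff]
  intro ε hε
  filter_upwards [tendsto_one_div_add_atTop_nhds_zero_nat.eventually_lt_const hε] with n hn t
  rw [dist_eq_norm]
  exact (hfp _ (by positivity) t).trans hn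

section BumpTrain

/-- The function equal to `x ↦ η m (x - m)` near each integer `m`. -/
noncomputable def bumpTrain (η : ℤ → ℝ → ℝ) (t : ℝ) : ℝ := η (round t) (t - round t)

variable {η : ℤ → ℝ → ℝ}

lemma bumpTrain_eq (hη : ∀ m x, 1 / 4 ≤ |x| → η m x = 0) {m : ℤ} {t : ℝ}
    (h : |t - m| < 3 / 4) : bumpTrain η t = η m (t - m) := by
  unfold bumpTrain
  by_cases hm : round t = m
  · rw [hm]
  have h1 : (1 : ℝ) ≤ |(round t : ℝ) - m| := by
    exact_mod_cast Int.one_le_abs (sub_ne_zero.mpr hm)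
  have h2 := abs_sub_round t
  have h3 := abs_sub_le (round t : ℝ) t m
  rw [abs_sub_comm (round t : ℝ) t] at h3
  rw [hη _ _ (by linarith), hη _ _ (by linarith)]

lemma bumpTrain_eventuallyEq (hη : ∀ m x, 1 / 4 ≤ |x| → η m x = 0) {m : ℤ} {t : ℝ}
    (h : |t - m| < 3 / 4) : bumpTrain η =ᶠ[𝓝 t] fun s => η m (s - m) := by
  have : ∀ᶠ s : ℝ in 𝓝 t, |s - m| < 3 / 4 :=
    ((continuous_id.sub continuous_const).abs.tendsto t).eventually_lt_const h
  filter_upwards [this] with s hs using bumpTrain_eq hη hs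

lemma contDiff_bumpTrain (hη : ∀ m x, 1 / 4 ≤ |x| → η m x = 0)
    (hs : ∀ m, ContDiff ℝ ∞ (η m)) : ContDiff ℝ ∞ (bumpTrain η) := by
  refine contDiff_iff_contDiffAt.mpr fun t => ?_
  refine ContDiffAt.congr_of_eventuallyEq ?_ (bumpTrain_eventuallyEq hη (m := round t)
    ((abs_sub_round t).trans_lt (by norm_num)))
  exact ((hs _).comp (contDiff_id.sub contDiff_const)).contDiffAt

lemma deriv_bumpTrain (hη : ∀ m x, 1 / 4 ≤ |x| → η m x = 0) {m : ℤ} {t : ℝ}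
    (h : |t - m| < 3 / 4) : deriv (bumpTrain η) t = deriv (η m) (t - m) := by
  rw [(bumpTrain_eventuallyEq hη h).deriv_eq, deriv_comp_sub_const]

lemma bumpTrain_periodic {p : ℤ} (hp : ∀ m, η (m + p) = η m) :
    Function.Periodic (bumpTrain η) p := by
  intro t
  simp only [bumpTrain, round_add_intCast, hp, Int.cast_add, add_sub_add_right_eq_sub]

end BumpTrain

/-- A smooth bump whose derivative vanishes at `0` but not identically on `(0, 1)`. -/
lemma exists_smooth_bump : ∃ ψ : ℝ → ℝ, ContDiff ℝ ∞ ψ ∧ (∀ x, |ψ x| ≤ 1) ∧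
    (∀ x, 1 ≤ |x| → ψ x = 0) ∧ deriv ψ 0 = 0 ∧ ∃ a, 0 < a ∧ a < 1 ∧ deriv ψ a ≠ 0 := by
  let f : ContDiffBump (0 : ℝ) := ⟨1 / 2, 1, by norm_num, by norm_num⟩
  have hz : ∀ x, 1 ≤ |x| → f x = 0 := fun x hx => f.zero_of_le_dist (by simpa [f] using hx)
  refine ⟨f, f.contDiff, fun x => by rw [abs_of_nonneg f.nonneg]; exact f.le_one, hz, ?_, ?_⟩
  · rw [f.eventuallyEq_one.deriv_eq]
    simp
  · obtain ⟨a, ha, h⟩ := exists_deriv_eq_slope f one_pos f.continuous.continuousOn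
      (f.contDiff.differentiable (n := 1) (by simp)).differentiableOn
    refine ⟨a, ha.1, ha.2, ?_⟩
    rw [h, hz 1 (by simp), f.eventuallyEq_one.eq_of_nhds]
    norm_num

section DyadicProfile

/-- The bump placed at the nonzero integer `m`: its width and height are of order
`1 / (v₂(m) + 4)`. -/
noncomputable def dyadicProfile (ψ : ℝ → ℝ) (m : ℤ) (x : ℝ) : ℝ :=
  if m = 0 then 0 else ψ ((padicValInt 2 m + 4) * x) / (padicValInt 2 m + 4)

/-- The profile `dyadicProfile` without the bumps at multiples of `2 ^ K`. -/
noncomputable def truncatedProfile (ψ : ℝ → ℝ) (K : ℕ) (m : ℤ) (x : ℝ) : ℝ :=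
  if (2 : ℤ) ^ K ∣ m then 0 else dyadicProfile ψ m x

variable {ψ : ℝ → ℝ}

lemma dyadicProfile_eq_zero (hψ : ∀ x, 1 ≤ |x| → ψ x = 0) (m : ℤ) (x : ℝ)
    (hx : 1 / 4 ≤ |x|) : dyadicProfile ψ m x = 0 := by
  unfold dyadicProfile
  split_ifs with hm
  · rfl
  rw [hψ, zero_div]
  have : (0 : ℝ) ≤ padicValInt 2 m := Nat.cast_nonneg _
  rw [abs_mul, abs_of_nonneg (by positivity)]
  nlinarith

lemma contDiff_dyadicProfile (hs : ContDiff ℝ ∞ ψ) (m : ℤ) :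
    ContDiff ℝ ∞ (dyadicProfile ψ m) := by
  unfold dyadicProfile
  split_ifs with hm
  · exact contDiff_const
  · exact (hs.comp (contDiff_const.mul contDiff_id)).div_const _

lemma deriv_dyadicProfile {m : ℤ} (hm : m ≠ 0) (x : ℝ) :
    deriv (dyadicProfile ψ m) x = deriv ψ ((padicValInt 2 m + 4) * x) := by
  have h0 : (padicValInt 2 m + 4 : ℝ) ≠ 0 := by positivity
  have : dyadicProfile ψ m =
      fun x => ψ ((padicValInt 2 m + 4) * x) / (padicValInt 2 m + 4) := by
    funext x
    simp [dyadicProfile, hm]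
  rw [this, deriv_div_const, deriv_comp_mul_left, smul_eq_mul, mul_div_cancel_left₀ _ h0]

lemma truncatedProfile_eq_zero (hψ : ∀ x, 1 ≤ |x| → ψ x = 0) (K : ℕ) (m : ℤ) (x : ℝ)
    (hx : 1 / 4 ≤ |x|) : truncatedProfile ψ K m x = 0 := by
  unfold truncatedProfile
  split_ifs
  · rfl
  · exact dyadicProfile_eq_zero hψ m x hx

lemma contDiff_truncatedProfile (hs : ContDiff ℝ ∞ ψ) (K : ℕ) (m : ℤ) :
    ContDiff ℝ ∞ (truncatedProfile ψ K m) := by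
  unfold truncatedProfile
  split_ifs
  · exact contDiff_const
  · exact contDiff_dyadicProfile hs m

lemma padicValInt_add_two_pow {K : ℕ} {m : ℤ} (hm : ¬ (2 : ℤ) ^ K ∣ m) :
    padicValInt 2 (m + 2 ^ K) = padicValInt 2 m := by
  have key : ∀ a : ℤ, ¬ (2 : ℤ) ^ K ∣ a → ∀ j, j ≤ padicValInt 2 a ↔ j ≤ K ∧ (2 : ℤ) ^ j ∣ a := by
    intro a ha j
    have hd := fun i => padicValInt_dvd_iff (p := 2) i a
    have ha0 : a ≠ 0 := fun h => ha (h ▸ dvd_zero _)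
    simp only [ha0, false_or, Nat.cast_ofNat] at hd
    rw [hd] at ha
    rw [hd]
    omega
  have hm' : ¬ (2 : ℤ) ^ K ∣ m + 2 ^ K := by rwa [dvd_add_self_right]
  refine eq_of_forall_le_iff fun j => ?_
  rw [key _ hm', key _ hm]
  refine and_congr_right fun hj => ?_
  rw [dvd_add_left (pow_dvd_pow 2 hj)]

lemma truncatedProfile_add (K : ℕ) (m : ℤ) :
    truncatedProfile ψ K (m + 2 ^ K) = truncatedProfile ψ K m := by
  funext x
  simp only [truncatedProfile, dvd_add_self_right]
  split_ifs with h
  · rfl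
  have h0 : m ≠ 0 := fun h' => h (h' ▸ dvd_zero _)
  have h1 : m + 2 ^ K ≠ 0 := fun h' => h (dvd_add_self_right.mp (h' ▸ dvd_zero _))
  simp only [dyadicProfile, h0, h1, if_false, padicValInt_add_two_pow h]

lemma abs_dyadicProfile_sub_truncatedProfile_le (hψ : ∀ x, |ψ x| ≤ 1) (K : ℕ) (m : ℤ) (x : ℝ) :
    |dyadicProfile ψ m x - truncatedProfile ψ K m x| ≤ 1 / (K + 1) := by
  have hK : (0 : ℝ) ≤ 1 / (K + 1) := by positivity
  unfold truncatedProfile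
  split_ifs with h
  · rw [sub_zero, dyadicProfile]
    split_ifs with hm
    · simpa using hK
    have hv : K ≤ padicValInt 2 m :=
      ((padicValInt_dvd_iff (p := 2) K m).mp (by exact_mod_cast h)).resolve_left hm
    have hv' : (K : ℝ) ≤ padicValInt 2 m := by exact_mod_cast hv
    rw [abs_div, abs_of_nonneg (by positivity : (0 : ℝ) ≤ padicValInt 2 m + 4)]
    exact div_le_div₀ zero_le_one (hψ _) (by positivity) (by linarith)
  · simpa using hK

/-- The dyadic bump train is almost periodic. -/
lemma bumpTrain_dyadicProfile_smul_mem_APR {X : Type*} [NormedAddCommGroup X] [NormedSpace ℝ X]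
    [NormedSpace ℂ X] [IsScalarTower ℝ ℂ X] (hs : ContDiff ℝ ∞ ψ) (hb : ∀ x, |ψ x| ≤ 1)
    (hψ : ∀ x, 1 ≤ |x| → ψ x = 0) (x₀ : X) :
    (fun t => bumpTrain (dyadicProfile ψ) t • x₀) ∈ APR X := by
  refine mem_APR_of_forall_exists_near fun ε hε => ?_
  have hδ : 0 < ε / 2 / (‖x₀‖ + 1) := by positivity
  obtain ⟨K, hK⟩ := exists_nat_one_div_lt hδ
  have hper : Function.Periodic (bumpTrain (truncatedProfile ψ K)) (2 ^ K : ℤ) :=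
    bumpTrain_periodic (truncatedProfile_add K)
  have hcont := (contDiff_bumpTrain (truncatedProfile_eq_zero hψ K)
    (contDiff_truncatedProfile hs K)).continuous
  obtain ⟨p, hp, hnear⟩ :=
    hper.exists_trigPoly_near (by positivity) hcont x₀ (half_pos hε)
  refine ⟨p, hp, fun t => ?_⟩
  have h1 : ‖bumpTrain (dyadicProfile ψ) t • x₀ - bumpTrain (truncatedProfile ψ K) t • x₀‖
      ≤ ε / 2 := by
    rw [← sub_smul, norm_smul, Real.norm_eq_abs]
    calc _ ≤ ε / 2 / (‖x₀‖ + 1) * ‖x₀‖ := by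
          gcongr
          exact (abs_dyadicProfile_sub_truncatedProfile_le hb K _ _).trans hK.le
      _ ≤ ε / 2 := by
          rw [div_mul_eq_mul_div, div_le_iff₀ (by positivity)]
          nlinarith [norm_nonneg x₀]
  calc _ ≤ _ := norm_sub_le_norm_sub_add_norm_sub _ (bumpTrain (truncatedProfile ψ K) t • x₀) _
    _ < ε := by linarith [hnear t]

lemma padicValInt_two_pow (k : ℕ) : padicValInt 2 ((2 : ℤ) ^ k) = k := by
  have h0 : (2 : ℤ) ^ k ≠ 0 := by positivity
  have hd := fun i => padicValInt_dvd_iff (p := 2) i ((2 : ℤ) ^ k)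
  simp only [h0, false_or, Nat.cast_ofNat] at hd
  refine eq_of_forall_le_iff fun j => ?_
  rw [← hd, pow_dvd_pow_iff two_ne_zero (by decide)]

lemma deriv_bumpTrain_dyadicProfile (hψ : ∀ x, 1 ≤ |x| → ψ x = 0) (k : ℕ) {x : ℝ}
    (hx : |x| < 3 / 4) :
    deriv (bumpTrain (dyadicProfile ψ)) (2 ^ k + x) = deriv ψ ((k + 4) * x) := by
  have h : (2 ^ k + x) - ((2 ^ k : ℤ) : ℝ) = x := by push_cast; ring
  rw [deriv_bumpTrain (m := 2 ^ k) (dyadicProfile_eq_zero hψ) (by rwa [h]), h,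
    deriv_dyadicProfile (by positivity), padicValInt_two_pow]

lemma deriv_eq_zero_of_one_lt (hψ : ∀ x, 1 ≤ |x| → ψ x = 0) {x : ℝ} (hx : 1 < x) :
    deriv ψ x = 0 := by
  have : ψ =ᶠ[𝓝 x] fun _ => 0 := by
    filter_upwards [lt_mem_nhds hx] with y hy using hψ y (hy.le.trans (le_abs_self y))
  rw [this.deriv_eq, deriv_const]

/-- Iterated difference quotients of the derivative of the dyadic bump train are not uniformly
continuous near `+∞`. -/
lemma not_uniformContinuousOn_diffQuot_iterate {X : Type*} [NormedAddCommGroup X]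
    [NormedSpace ℝ X] (hs : ContDiff ℝ ∞ ψ) (hψ : ∀ x, 1 ≤ |x| → ψ x = 0)
    (h0 : deriv ψ 0 = 0) {a : ℝ} (ha0 : 0 < a) (ha1 : a < 1) (ha : deriv ψ a ≠ 0) {x₀ : X}
    (hx₀ : x₀ ≠ 0) {J : Set ℝ} {B : ℝ} (hJ : ∀ t, B < t → t ∈ J) (n : ℕ) :
    ¬ UniformContinuousOn ((diffQuot (1 / (2 * (n + 1))))^[n]
      (deriv fun t => bumpTrain (dyadicProfile ψ) t • x₀)) J := by
  intro hu
  set h : ℝ := 1 / (2 * (n + 1)) with hh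
  have hpos : 0 < h := by positivity
  have hsmooth := contDiff_bumpTrain (dyadicProfile_eq_zero hψ) (contDiff_dyadicProfile hs)
  have hderiv : (deriv fun t => bumpTrain (dyadicProfile ψ) t • x₀) =
      fun t => deriv (bumpTrain (dyadicProfile ψ)) t • x₀ := by
    funext t
    exact deriv_smul_const ((hsmooth.differentiable (by simp)) t) x₀
  rw [hderiv] at hu
  have hc : 0 < ‖(-(1 / h)) ^ n • deriv ψ a • x₀‖ := by
    rw [norm_pos_iff]
    exact smul_ne_zero (pow_ne_zero _ (neg_ne_zero.mpr (by positivity))) (smul_ne_zero ha hx₀)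
  obtain ⟨δ, hδ, hu⟩ := Metric.uniformContinuousOn_iff.mp hu _ hc
  obtain ⟨k, hkB, hkδ, hkh⟩ : ∃ k : ℕ, B < k ∧ 1 / δ < k ∧ 1 / h < k := by
    obtain ⟨k, hk⟩ := exists_nat_gt (max B (max (1 / δ) (1 / h)))
    simp only [max_lt_iff] at hk
    exact ⟨k, hk⟩
  have hk4 : (0 : ℝ) < k + 4 := by positivity
  have hk2 : (k : ℝ) < 2 ^ k := by exact_mod_cast Nat.lt_two_pow_self
  have hval : ∀ b, 0 ≤ b → b < 1 →
      (diffQuot h)^[n] (fun t => deriv (bumpTrain (dyadicProfile ψ)) t • x₀) (2 ^ k + b / (k + 4))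
        = (-(1 / h)) ^ n • deriv ψ b • x₀ := by
    intro b hb0 hb1
    have hx0 : 0 ≤ b / (k + 4) := by positivity
    have hx1 : b / (k + 4) < 1 / 4 := by
      rw [div_lt_div_iff₀ hk4 (by norm_num)]
      nlinarith [Nat.cast_nonneg (α := ℝ) k]
    rw [diffQuot_iterate_apply]
    · rw [deriv_bumpTrain_dyadicProfile hψ k (by rw [abs_of_nonneg hx0]; linarith),
        mul_div_cancel₀ _ hk4.ne']
    · intro j hj hjn
      have hj1 : (1 : ℝ) ≤ j := by exact_mod_cast hj
      have hj2 : (j : ℝ) ≤ n := by exact_mod_cast hjn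
      have hjh : h ≤ j * h := by nlinarith
      have hjh' : j * h ≤ 1 / 2 := by
        rw [hh, mul_one_div, div_le_div_iff₀ (by positivity) (by norm_num)]
        linarith
      have hkh' : 1 < k * h := (div_lt_iff₀ hpos).mp hkh
      rw [add_assoc, deriv_bumpTrain_dyadicProfile hψ k
          (by rw [abs_of_nonneg (by positivity)]; linarith),
        deriv_eq_zero_of_one_lt hψ ?_, zero_smul]
      nlinarith [Nat.cast_nonneg (α := ℝ) k]
  have hak : a / (k + 4) < δ := by
    rw [div_lt_iff₀ hk4]
    have := (div_lt_iff₀ hδ).mp hkδ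
    nlinarith
  have hpos' : 0 < a / (k + 4) := by positivity
  have := hu (2 ^ k + a / (k + 4)) (hJ _ (by linarith)) (2 ^ k + 0 / (k + 4))
    (hJ _ (by rw [zero_div]; linarith))
    (by rw [dist_add_left, zero_div, Real.dist_eq, sub_zero, abs_of_pos hpos']; exact hak)
  rw [hval a ha0.le ha1, hval 0 le_rfl one_pos, h0, zero_smul, smul_zero, dist_zero_right] at this
  exact lt_irrefl _ this

end DyadicProfile

/-- If `𝒜 ⊆ C_u(𝕁,X)` is real-linear and positive-invariant with
`AP(𝕁,X) ⊆ 𝒜 ⊆ M𝒜` (`X` a nonzero complex Banach space), then all inclusions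
`M^{n}𝒜 ⊆ M^{n+1}𝒜` are strict. -/
theorem prop_3_8 {X : Type*} [NormedAddCommGroup X] [NormedSpace ℝ X] [NormedSpace ℂ X]
    [IsScalarTower ℝ ℂ X] [CompleteSpace X] [Nontrivial X]
    (J : Set ℝ)
    (hJ : J = Set.univ ∨ (∃ α : ℝ, J = Set.Ioi α) ∨ (∃ α : ℝ, J = Set.Ici α))
    (A : Set (ℝ → X))
    (hACu : ∀ f ∈ A, UniformContinuousOn f J)
    (hlin : ∀ f ∈ A, ∀ g ∈ A, ∀ s t : ℝ, (fun x => s • f x + t • g x) ∈ A)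
    (hinv : ∀ f ∈ A, ∀ a : ℝ, 0 ≤ a → (fun t => f (t + a)) ∈ A)
    (hAP : APJ J ⊆ A)
    (hMA : A ⊆ meanClass J A) :
    ∀ n : ℕ, meanClassIter J A n ⊂ meanClassIter J A (n + 1) := by
  have hdq : ∀ f ∈ A, ∀ h : ℝ, 0 < h → diffQuot h f ∈ A := by
    intro f hf h hh
    have := hlin _ (hinv f hf h hh.le) f hf (1 / h) (-(1 / h))
    unfold diffQuot
    simpa only [smul_sub, neg_smul, ← sub_eq_add_neg] using this
  obtain ⟨B, hB⟩ : ∃ B : ℝ, ∀ t, B < t → t ∈ J := by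
    rcases hJ with rfl | ⟨α, rfl⟩ | ⟨α, rfl⟩
    · exact ⟨0, fun t _ => mem_univ t⟩
    · exact ⟨α, fun t ht => ht⟩
    · exact ⟨α, fun t ht => ht.le⟩
  obtain ⟨ψ, hs, hb, hψ, h0, a, ha0, ha1, ha⟩ := exists_smooth_bump
  obtain ⟨x₀, hx₀⟩ := exists_ne (0 : X)
  have hU : ContDiff ℝ ∞ fun t => bumpTrain (dyadicProfile ψ) t • x₀ :=
    (contDiff_bumpTrain (dyadicProfile_eq_zero hψ) (contDiff_dyadicProfile hs)).smul
      contDiff_const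
  have hUA : (fun t => bumpTrain (dyadicProfile ψ) t • x₀) ∈ A :=
    hAP ⟨_, bumpTrain_dyadicProfile_smul_mem_APR hs hb hψ x₀, fun _ _ => rfl⟩
  intro n
  refine ⟨meanClassIter_subset_succ hMA n, fun hsub => ?_⟩
  have hmem := hsub (iteratedDeriv_mem_meanClassIter hdq (n + 1) hU hUA)
  rw [iteratedDeriv_succ'] at hmem
  exact not_uniformContinuousOn_diffQuot_iterate hs hψ h0 ha0 ha1 ha hx₀ hB n
    (hACu _ (diffQuot_iterate_mem (by positivity) n (contDiff_infty_iff_deriv.mp hU).2 hmem))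
end

section
/- Let 𝕁 be an interval of the form ℝ, (α,∞) or [α,∞), X a Banach space, and let 𝒜 ⊆ C_ub(𝕁,X) be ℚ-convex and uniformly closed. Then 𝒜 satisfies condition (Δ): for every φ ∈ L¹_loc(𝕁,X) with Δ_s φ ∈ 𝒜 for all s > 0 one has φ − M_h φ ∈ 𝒜 for all h > 0. -/
open MeasureTheory Set Filter

section UniformContinuity

variable {X : Type*} [NormedAddCommGroup X] {J : Set ℝ} {φ : ℝ → X}

lemma intervalIntegrable_of_isUpperSet (hJ : IsUpperSet J) (hφ : LocallyIntegrableOn φ J)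
    {a b : ℝ} (ha : a ∈ J) (hb : b ∈ J) : IntervalIntegrable φ volume a b := by
  have hmin : min a b ∈ J := by rcases min_choice a b with h | h <;> rwa [h]
  exact (hφ.integrableOn_compact_subset (fun x hx => hJ hx.1 hmin)
    isCompact_uIcc).intervalIntegrable

lemma intervalIntegrable_translate (hJ : IsUpperSet J) (hφ : LocallyIntegrableOn φ J)
    {t a b : ℝ} (ht : t ∈ J) (ha : 0 ≤ a) (hb : 0 ≤ b) :
    IntervalIntegrable (fun s => φ (t + s)) volume a b := by
  have h := (intervalIntegrable_of_isUpperSet hJ hφ (hJ (show t ≤ t + a by linarith) ht)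
    (hJ (show t ≤ t + b by linarith) ht)).comp_add_left t
  simpa using h

/-- If all differences `Δ_s φ` are bounded along a sequence in `J`, then a common bound holds on a
set of `s` of almost full measure. -/
lemma exists_bound_differences_of_lt_measure (hJ : IsUpperSet J) (hφ : LocallyIntegrableOn φ J)
    (hB : ∀ s : ℝ, 0 < s → ∃ C : ℝ, ∀ t ∈ J, ‖φ (t + s) - φ t‖ ≤ C)
    {u : ℕ → ℝ} (hu : ∀ n, u n ∈ J) {b : ℝ} (hb : 0 ≤ b) {c : ENNReal}
    (hc : c < volume (Ioc 0 b)) :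
    ∃ k : ℕ, ∃ E ⊆ Ioc 0 b, NullMeasurableSet E volume ∧ c < volume E ∧
      ∀ s ∈ E, ∀ n, ‖φ (u n + s) - φ (u n)‖ ≤ k := by
  let E : ℕ → Set ℝ := fun k => (⋂ n, {s | ‖φ (u n + s) - φ (u n)‖ ≤ k}) ∩ Ioc 0 b
  have hmono : Monotone E := fun k l hkl s hs =>
    ⟨mem_iInter.2 fun n => (mem_ofPred.1 (mem_iInter.1 hs.1 n)).trans (Nat.cast_le.2 hkl), hs.2⟩
  have hUnion : ⋃ k, E k = Ioc 0 b := by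
    refine subset_antisymm (iUnion_subset fun k => inter_subset_right) fun s hs => ?_
    obtain ⟨C, hC⟩ := hB s hs.1
    obtain ⟨k, hk⟩ := exists_nat_ge C
    exact mem_iUnion.2 ⟨k, mem_iInter.2 fun n => (hC _ (hu n)).trans hk, hs⟩
  have hlim := tendsto_measure_iUnion_atTop (μ := volume) hmono
  rw [hUnion] at hlim
  obtain ⟨k, hk⟩ := (hlim.eventually (lt_mem_nhds hc)).exists
  refine ⟨k, E k, inter_subset_right, ?_, hk, fun s hs n => mem_iInter.1 hs.1 n⟩
  refine (nullMeasurableSet_restrict measurableSet_Ioc.nullMeasurableSet).1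
    (NullMeasurableSet.iInter fun n => ?_)
  have hint := intervalIntegrable_translate hJ hφ (hu n) le_rfl hb
  exact (hint.1.aestronglyMeasurable.sub aestronglyMeasurable_const).norm.aemeasurable
    |>.nullMeasurable measurableSet_Iic

lemma exists_bound_differences (hJ : IsUpperSet J) (hφ : LocallyIntegrableOn φ J)
    (hB : ∀ s : ℝ, 0 < s → ∃ C : ℝ, ∀ t ∈ J, ‖φ (t + s) - φ t‖ ≤ C)
    {h : ℝ} (hh : 0 < h) :
    ∃ C : ℝ, ∀ t ∈ J, ∀ s ∈ Ioc 0 h, ‖φ (t + s) - φ t‖ ≤ C := by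
  by_contra! hcon
  choose t ht s hs hts using fun n : ℕ => hcon n
  have hlt : ENNReal.ofReal (3 * h / 2) < volume (Ioc 0 (2 * h)) := by
    rw [Real.volume_Ioc]
    exact (ENNReal.ofReal_lt_ofReal_iff (by linarith)).2 (by linarith)
  obtain ⟨k, E, hEsub, hEm, hE, hEk⟩ :=
    exists_bound_differences_of_lt_measure hJ hφ hB ht (by linarith) hlt
  obtain ⟨l, F, hFsub, -, hF, hFl⟩ :=
    exists_bound_differences_of_lt_measure hJ hφ hB
      (fun n => hJ (show t n ≤ t n + s n by linarith [(hs n).1]) (ht n)) (by linarith) hlt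
  set n := k + l
  set G : Set ℝ := (fun x => x + -s n) ⁻¹' F
  have hG : volume G = volume F := measure_preimage_add_right volume (-s n) F
  have hnd : ¬ Disjoint G E := by
    intro hd
    have hsub : G ∪ E ⊆ Ioc 0 (3 * h) := by
      rintro x (hx | hx)
      · have := hFsub hx
        constructor <;> linarith [this.1, this.2, (hs n).1, (hs n).2]
      · have := hEsub hx
        exact ⟨this.1, by linarith [this.2]⟩
    have h1 := measure_mono (μ := volume) hsub
    rw [measure_union₀ hEm hd.aedisjoint, hG, Real.volume_Ioc] at h1
    have h2 := ENNReal.add_lt_add hF hE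
    rw [← ENNReal.ofReal_add (by linarith) (by linarith)] at h2
    refine absurd (h2.trans_le h1) (not_lt.2 (ENNReal.ofReal_le_ofReal (by linarith)))
  obtain ⟨x, hxG, hxE⟩ := not_disjoint_iff.1 hnd
  have h1 := hFl _ hxG n
  have h2 := hEk _ hxE n
  rw [show t n + s n + (x + -s n) = t n + x by ring] at h1
  have h3 : ‖φ (t n + s n) - φ (t n)‖ ≤ l + k := by
    calc ‖φ (t n + s n) - φ (t n)‖
        = ‖(φ (t n + x) - φ (t n)) - (φ (t n + x) - φ (t n + s n))‖ := by congr 1; abel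
      _ ≤ k + l := (norm_sub_le _ _).trans (add_le_add h2 h1)
      _ = l + k := add_comm _ _
  have h4 := hts n
  simp only [n] at h3 h4
  push_cast at h4
  linarith

lemma norm_integral_translate_sub_le [NormedSpace ℝ X] (hJ : IsUpperSet J)
    (hφ : LocallyIntegrableOn φ J) {h C : ℝ} (hh : 0 ≤ h)
    (hC : ∀ t ∈ J, ‖φ (t + h) - φ t‖ ≤ C) {t r : ℝ} (ht : t ∈ J) (hr : 0 ≤ r) :
    ‖(∫ s in (0 : ℝ)..h, φ (t + r + s)) - ∫ s in (0 : ℝ)..h, φ (t + s)‖ ≤ C * r := by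
  have mem : ∀ {x}, t ≤ x → x ∈ J := fun hx => hJ hx ht
  have hint : ∀ {a b : ℝ}, t ≤ a → t ≤ b → IntervalIntegrable φ volume a b :=
    fun ha hb => intervalIntegrable_of_isUpperSet hJ hφ (mem ha) (mem hb)
  have htr : t + r ∈ J := mem (by linarith)
  have key : (∫ s in (0 : ℝ)..h, φ (t + r + s)) - ∫ s in (0 : ℝ)..h, φ (t + s)
      = ∫ s in (0 : ℝ)..r, (φ (t + s + h) - φ (t + s)) := by
    have hadd : IntervalIntegrable (fun s => φ (t + s + h)) volume 0 r := by
      simpa only [add_right_comm] using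
        intervalIntegrable_translate hJ hφ (mem (show t ≤ t + h by linarith)) le_rfl hr
    rw [intervalIntegral.integral_sub hadd (intervalIntegrable_translate hJ hφ ht le_rfl hr)]
    simp only [add_right_comm t _ h]
    simp only [intervalIntegral.integral_comp_add_left, add_zero]
    rw [intervalIntegral.integral_interval_sub_interval_comm'
      (hint (by linarith) (by linarith)) (hint (by linarith) (by linarith))
      (hint (by linarith) (by linarith)), add_right_comm t r h]
  rw [key]
  refine (intervalIntegral.norm_integral_le_of_norm_le_const fun s hs => ?_).trans
    (by rw [sub_zero, abs_of_nonneg hr])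
  rw [uIoc_of_le hr] at hs
  exact hC _ (mem (by linarith [hs.1]))

/-- A locally integrable function whose differences are bounded and uniformly continuous is itself
uniformly continuous. -/
lemma exists_delta_of_differences [NormedSpace ℝ X] [CompleteSpace X] (hJ : IsUpperSet J)
    (hφ : LocallyIntegrableOn φ J)
    (hB : ∀ s : ℝ, 0 < s → ∃ C : ℝ, ∀ t ∈ J, ‖φ (t + s) - φ t‖ ≤ C)
    (hU : ∀ s : ℝ, 0 < s → UniformContinuousOn (fun t => φ (t + s) - φ t) J)
    {ε : ℝ} (hε : 0 < ε) :
    ∃ δ > 0, ∀ t ∈ J, ∀ r, 0 ≤ r → r ≤ δ → ‖φ (t + r) - φ t‖ ≤ ε := by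
  by_contra! hcon
  choose t ht r hr0 hr htr using fun n : ℕ => hcon (1 / ((n : ℝ) + 1)) (by positivity)
  have hrlim : Tendsto r atTop (nhds 0) :=
    squeeze_zero hr0 hr tendsto_one_div_add_atTop_nhds_zero_nat
  obtain ⟨C, hC⟩ := exists_bound_differences hJ hφ hB one_pos
  have htr' : ∀ n, t n + r n ∈ J := fun n => hJ (by linarith [hr0 n]) (ht n)
  let f : ℕ → ℝ → X := fun n s =>
    (φ (t n + r n + s) - φ (t n + r n)) - (φ (t n + s) - φ (t n))
  have hi₁ : ∀ n, IntervalIntegrable (fun s => φ (t n + r n + s)) volume 0 1 := fun n =>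
    intervalIntegrable_translate hJ hφ (htr' n) le_rfl zero_le_one
  have hi₂ : ∀ n, IntervalIntegrable (fun s => φ (t n + s)) volume 0 1 := fun n =>
    intervalIntegrable_translate hJ hφ (ht n) le_rfl zero_le_one
  have hlim : Tendsto (fun n => ∫ s in (0 : ℝ)..1, f n s) atTop
      (nhds (∫ _ in (0 : ℝ)..1, (0 : X))) := by
    refine intervalIntegral.tendsto_integral_filter_of_dominated_convergence (fun _ => C + C)
      (Eventually.of_forall fun n => ?_)
      (Eventually.of_forall fun n => Eventually.of_forall fun s hs => ?_)
      intervalIntegrable_const (Eventually.of_forall fun s hs => ?_)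
    · rw [uIoc_of_le zero_le_one]
      exact ((hi₁ n).1.aestronglyMeasurable.sub aestronglyMeasurable_const).sub
        ((hi₂ n).1.aestronglyMeasurable.sub aestronglyMeasurable_const)
    · rw [uIoc_of_le zero_le_one] at hs
      exact (norm_sub_le _ _).trans (add_le_add (hC _ (htr' n) s hs) (hC _ (ht n) s hs))
    · rw [uIoc_of_le zero_le_one] at hs
      rw [Metric.tendsto_nhds]
      intro η hη
      obtain ⟨δ, hδ, H⟩ := Metric.uniformContinuousOn_iff.1 (hU s hs.1) η hη
      filter_upwards [hrlim.eventually (gt_mem_nhds hδ)] with n hn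
      have := H _ (htr' n) _ (ht n) (by
        rw [Real.dist_eq, add_sub_cancel_left, abs_of_nonneg (hr0 n)]; exact hn)
      rwa [dist_zero_right, ← dist_eq_norm]
  have hsplit : ∀ n, (∫ s in (0 : ℝ)..1, f n s) =
      ((∫ s in (0 : ℝ)..1, φ (t n + r n + s)) - ∫ s in (0 : ℝ)..1, φ (t n + s)) -
        (φ (t n + r n) - φ (t n)) := by
    intro n
    simp only [f]
    rw [intervalIntegral.integral_sub ((hi₁ n).sub intervalIntegrable_const)
      ((hi₂ n).sub intervalIntegrable_const),
      intervalIntegral.integral_sub (hi₁ n) intervalIntegrable_const,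
      intervalIntegral.integral_sub (hi₂ n) intervalIntegrable_const]
    simp only [intervalIntegral.integral_const, sub_zero, one_smul]
    abel
  have hmean : Tendsto (fun n => (∫ s in (0 : ℝ)..1, φ (t n + r n + s)) -
      ∫ s in (0 : ℝ)..1, φ (t n + s)) atTop (nhds 0) := by
    refine squeeze_zero_norm (a := fun n => C * r n) (fun n => ?_) (by simpa using hrlim.const_mul C)
    exact norm_integral_translate_sub_le hJ hφ zero_le_one
      (fun x hx => hC x hx 1 ⟨one_pos, le_rfl⟩) (ht n) (hr0 n)
  have hzero : Tendsto (fun n => φ (t n + r n) - φ (t n)) atTop (nhds 0) := by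
    have := hmean.sub hlim
    simpa [hsplit] using this
  obtain ⟨n, hn⟩ := (hzero.norm.eventually (gt_mem_nhds (by simpa using hε))).exists
  exact lt_asymm hn (htr n)

end UniformContinuity

/-- The right-endpoint Riemann sum with `m` equal steps approximates an average over `[0, h]` up to
the oscillation on steps of length `h / m`. -/
lemma norm_riemannSum_sub_mean_le {X : Type*} [NormedAddCommGroup X] [NormedSpace ℝ X]
    [CompleteSpace X] {g : ℝ → X} {h ε : ℝ} (hh : 0 < h) {m : ℕ} (hm : 0 < m)
    (hg : IntervalIntegrable g volume 0 h)
    (hosc : ∀ s, 0 ≤ s → ∀ r, 0 ≤ r → r ≤ h / m → ‖g (s + r) - g s‖ ≤ ε) :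
    ‖(1 / (m : ℝ)) • ∑ k ∈ Finset.range m, g ((k + 1 : ℕ) * (h / m)) -
      (1 / h) • ∫ s in (0 : ℝ)..h, g s‖ ≤ ε := by
  have hm' : (0 : ℝ) < m := Nat.cast_pos.2 hm
  have hd : 0 < h / m := by positivity
  set d := h / m with hd_def
  have hmd : (m : ℝ) * d = h := by rw [hd_def]; field_simp
  have hint : ∀ k < m, IntervalIntegrable g volume ((k : ℕ) * d) ((k + 1 : ℕ) * d) := by
    intro k hk
    have hk' : ((k + 1 : ℕ) : ℝ) ≤ m := Nat.cast_le.2 hk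
    have h1 : ((k + 1 : ℕ) : ℝ) * d ≤ h := hmd ▸ mul_le_mul_of_nonneg_right hk' hd.le
    have h2 : (k : ℝ) * d ≤ (k + 1 : ℕ) * d :=
      mul_le_mul_of_nonneg_right (Nat.cast_le.2 k.le_succ) hd.le
    refine hg.mono_set ?_
    rw [uIcc_of_le h2, uIcc_of_le hh.le]
    exact Icc_subset_Icc (by positivity) h1
  have hsum := intervalIntegral.sum_integral_adjacent_intervals (a := fun k : ℕ => (k : ℝ) * d) hint
  simp only [Nat.cast_zero, zero_mul, hmd] at hsum
  have hrw : (1 / (m : ℝ)) • ∑ k ∈ Finset.range m, g ((k + 1 : ℕ) * d) -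
      (1 / h) • ∫ s in (0 : ℝ)..h, g s =
      (1 / h) • ∑ k ∈ Finset.range m,
        ∫ s in ((k : ℕ) * d)..((k + 1 : ℕ) * d), (g ((k + 1 : ℕ) * d) - g s) := by
    have hk : ∀ k ∈ Finset.range m,
        ∫ s in ((k : ℕ) * d)..((k + 1 : ℕ) * d), (g ((k + 1 : ℕ) * d) - g s) =
        d • g ((k + 1 : ℕ) * d) - ∫ s in ((k : ℕ) * d)..((k + 1 : ℕ) * d), g s := by
      intro k hk
      rw [intervalIntegral.integral_sub intervalIntegrable_const (hint k (Finset.mem_range.1 hk)),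
        intervalIntegral.integral_const]
      congr 2
      push_cast
      ring
    rw [Finset.sum_congr rfl hk, Finset.sum_sub_distrib, hsum, ← Finset.smul_sum, smul_sub, smul_smul,
      show 1 / h * d = 1 / (m : ℝ) by rw [hd_def]; field_simp]
  rw [hrw, norm_smul, Real.norm_of_nonneg (by positivity)]
  have hle : ‖∑ k ∈ Finset.range m,
      ∫ s in ((k : ℕ) * d)..((k + 1 : ℕ) * d), (g ((k + 1 : ℕ) * d) - g s)‖ ≤
      ∑ _k ∈ Finset.range m, ε * d := by
    refine norm_sum_le_of_le _ fun k _ => ?_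
    have hstep : ((k + 1 : ℕ) : ℝ) * d = k * d + d := by push_cast; ring
    refine (intervalIntegral.norm_integral_le_of_norm_le_const fun s hs => ?_).trans_eq
      (by rw [hstep, add_sub_cancel_left, abs_of_pos hd])
    rw [hstep] at hs ⊢
    rw [uIoc_of_le (by linarith)] at hs
    have hk0 : 0 ≤ (k : ℝ) * d := by positivity
    have := hosc s (by linarith [hs.1]) (k * d + d - s) (by linarith [hs.2]) (by linarith [hs.1])
    rwa [add_sub_cancel] at this
  calc 1 / h * _ ≤ 1 / h * ∑ _k ∈ Finset.range m, ε * d :=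
        mul_le_mul_of_nonneg_left hle (by positivity)
    _ = ε := by
        rw [Finset.sum_const, Finset.card_range, nsmul_eq_mul, mul_left_comm (m : ℝ), hmd]
        field_simp

/-- Proposition 4.2 (i).  If `𝒜 ⊆ C_ub(𝕁,X)` is ℚ-convex and uniformly
closed, then `𝒜` satisfies condition (Δ): whenever `φ ∈ L¹_loc(𝕁,X)` with `Δ_s φ ∈ 𝒜` for
all `s > 0`, one has `φ − M_h φ ∈ 𝒜` for all `h > 0`. -/
theorem prop_4_2_i {X : Type*} [NormedAddCommGroup X] [NormedSpace ℝ X] [CompleteSpace X]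
    (J : Set ℝ)
    (hJ : J = Set.univ ∨ (∃ α : ℝ, J = Set.Ioi α) ∨ (∃ α : ℝ, J = Set.Ici α))
    (A : Set (ℝ → X))
    (hACub : ∀ f ∈ A, UniformContinuousOn f J ∧ ∃ C : ℝ, ∀ t ∈ J, ‖f t‖ ≤ C)
    (hQconv : ∀ m : ℕ, 0 < m → ∀ F : Fin m → ℝ → X, (∀ k, F k ∈ A) →
      (fun t => (-(1 / (m : ℝ))) • ∑ k, F k t) ∈ A)
    (hclosed : ∀ (F : ℕ → ℝ → X) (f : ℝ → X), (∀ n, F n ∈ A) →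
      TendstoUniformlyOn F f atTop J → f ∈ A) :
    ∀ φ : ℝ → X, LocallyIntegrableOn φ J →
      (∀ s : ℝ, 0 < s → (fun t => φ (t + s) - φ t) ∈ A) →
      ∀ h : ℝ, 0 < h → (fun t => φ t - meanM h φ t) ∈ A := by
  intro φ hφ hΔ h hh
  have hup : IsUpperSet J := by
    rcases hJ with rfl | ⟨α, rfl⟩ | ⟨α, rfl⟩
    exacts [isUpperSet_univ, isUpperSet_Ioi α, isUpperSet_Ici α]
  have hosc : ∀ {ε : ℝ}, 0 < ε → ∃ δ > 0, ∀ t ∈ J, ∀ r, 0 ≤ r → r ≤ δ → ‖φ (t + r) - φ t‖ ≤ ε :=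
    exists_delta_of_differences hup hφ (fun s hs => (hACub _ (hΔ s hs)).2)
      (fun s hs => (hACub _ (hΔ s hs)).1)
  refine hclosed (fun n t => (-(1 / ((n + 1 : ℕ) : ℝ))) •
    ∑ k : Fin (n + 1), (φ (t + ((k : ℕ) + 1 : ℕ) * (h / (n + 1 : ℕ))) - φ t)) _
    (fun n => hQconv (n + 1) n.succ_pos
      (fun k t => φ (t + ((k : ℕ) + 1 : ℕ) * (h / (n + 1 : ℕ))) - φ t)
      fun k => hΔ _ (by positivity)) ?_
  rw [Metric.tendstoUniformlyOn_iff]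
  intro ε hε
  obtain ⟨δ, hδ, H⟩ := hosc (half_pos hε)
  have hstep : Tendsto (fun n : ℕ => h / (n + 1 : ℕ)) atTop (nhds 0) :=
    (tendsto_const_div_atTop_nhds_zero_nat h).comp (tendsto_add_atTop_nat 1)
  filter_upwards [hstep.eventually (gt_mem_nhds hδ)] with n hn t ht
  have hR := norm_riemannSum_sub_mean_le (g := fun s => φ (t + s)) hh n.succ_pos
    (intervalIntegrable_translate hup hφ ht le_rfl hh.le) (ε := ε / 2) (fun s hs r hr hrn => by
      rw [← add_assoc]
      exact H _ (hup (show t ≤ t + s by linarith) ht) r hr (hrn.trans hn.le))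
  refine lt_of_eq_of_lt ?_ (hR.trans_lt (half_lt_self hε))
  rw [dist_eq_norm]
  congr 1
  rw [Fin.sum_univ_eq_sum_range
    (fun k => φ (t + ((k + 1 : ℕ) : ℝ) * (h / (n + 1 : ℕ))) - φ t) (n + 1),
    Finset.sum_sub_distrib, Finset.sum_const, Finset.card_range, ← Nat.cast_smul_eq_nsmul ℝ,
    neg_smul, smul_sub, smul_smul, one_div_mul_cancel (by positivity), one_smul, meanM]
  abel
end

section
/- Let 𝕁 be an interval of the form ℝ, (α,∞) or [α,∞), X a Banach space, 1 ≤ p ≤ ∞, and let w : 𝕁 → [0,∞) be measurable such that for some real c > 0 one has w(t+h) ≤ c·w(t) and w(t) ≤ c·w(t+h) for a.e. t ∈ 𝕁 and all 0 < h ≤ 1. Then the weighted space L^p_w(𝕁,X) satisfies condition (Δ): for every φ ∈ L¹_loc(𝕁,X) such that Δ_s φ ∈ L^p_w(𝕁,X) for all s > 0, one has φ − M_h φ ∈ L^p_w(𝕁,X) for all h > 0. -/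
open MeasureTheory Set
open scoped ENNReal

/-- Membership in the weighted space `L^p_w(𝕁,X)`, `1 ≤ p ≤ ∞`:
for `p < ∞`, `∫_𝕁 w(t)‖f(t)‖^p dt < ∞`; for `p = ∞`, `w·‖f‖` essentially bounded on `𝕁`. -/
noncomputable def memLpw {X : Type*} [NormedAddCommGroup X]
    (J : Set ℝ) (w : ℝ → ℝ) (p : ℝ≥0∞) (f : ℝ → X) : Prop :=
  AEStronglyMeasurable f (volume.restrict J) ∧
    if p = ∞ then ∃ C : ℝ, ∀ᵐ t ∂(volume.restrict J), w t * ‖f t‖ ≤ C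
    else ∫⁻ t in J, ENNReal.ofReal (w t * ‖f t‖ ^ p.toReal) < ∞

section WeightedDifferences

lemma IsUpperSet.subset_preimage_add_const {J : Set ℝ} (hJ : IsUpperSet J) {r : ℝ} (hr : 0 ≤ r) :
    J ⊆ (· + r) ⁻¹' J :=
  fun _ ht => hJ (le_add_of_nonneg_right hr) ht

lemma measurableSet_eLpNorm_section_le {E α β : Type*} [NormedAddCommGroup E]
    [MeasurableSpace α] [MeasurableSpace β] {μ : Measure β} [SFinite μ] {p : ℝ≥0∞} (hp : 1 ≤ p)
    {G : α → β → E} (hG : StronglyMeasurable (Function.uncurry G)) (K : ℝ≥0∞) :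
    MeasurableSet {s | eLpNorm (G s) p μ ≤ K} := by
  have hE : Measurable (fun z : α × β => ‖G z.1 z.2‖ₑ) := hG.enorm
  by_cases htop : p = ∞
  · subst htop
    have hset : {s | eLpNorm (G s) ∞ μ ≤ K}
        = (fun s => μ (Prod.mk s ⁻¹' {z : α × β | K < ‖G z.1 z.2‖ₑ})) ⁻¹' {0} := by
      ext s
      have : (∀ᵐ t ∂μ, ‖G s t‖ₑ ≤ K) ↔ μ {t | K < ‖G s t‖ₑ} = 0 := by
        simp [ae_iff]
      simp only [eLpNorm_exponent_top, mem_ofPred_eq, mem_preimage, mem_singleton_iff]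
      rw [preimage_ofPred_eq, ← this]
      exact ⟨fun h => (ae_le_eLpNormEssSup (f := G s)).mono fun t ht => ht.trans h,
        eLpNormEssSup_le_of_ae_enorm_bound⟩
    rw [hset]
    exact measurable_measure_prodMk_left (measurableSet_lt measurable_const hE)
      (measurableSet_singleton 0)
  · have hp0 : p ≠ 0 := (zero_lt_one.trans_le hp).ne'
    simp_rw [eLpNorm_eq_lintegral_rpow_enorm_toReal hp0 htop]
    exact measurableSet_le (((hE.pow_const _).lintegral_prod_right').pow_const _) measurable_const

lemma eLpNorm_comp_add_restrict_le {E : Type*} [NormedAddCommGroup E] {J : Set ℝ}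
    (hJm : MeasurableSet J) (hJu : IsUpperSet J) {p : ℝ≥0∞} {g : ℝ → E}
    (hg : StronglyMeasurable g) {r : ℝ} (hr : 0 ≤ r) :
    eLpNorm (fun t => g (t + r)) p (volume.restrict J) ≤ eLpNorm g p (volume.restrict J) := by
  have hmp := (measurePreserving_add_right (volume : Measure ℝ) r).restrict_preimage hJm
  calc eLpNorm (fun t => g (t + r)) p (volume.restrict J)
      ≤ eLpNorm (g ∘ (· + r)) p (volume.restrict ((· + r) ⁻¹' J)) :=
        eLpNorm_mono_measure _ <| Measure.restrict_mono
          (hJu.subset_preimage_add_const hr) le_rfl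
    _ = eLpNorm g p (volume.restrict J) :=
        eLpNorm_comp_measurePreserving hg.aestronglyMeasurable hmp

variable {E : Type*} [NormedAddCommGroup E] [NormedSpace ℝ E]

/-- Minkowski's integral inequality for a probability measure, with a uniform bound on the
sections. -/
lemma eLpNorm_integral_le_of_ae_le {α β : Type*} [MeasurableSpace α] [MeasurableSpace β]
    {ρ : Measure α} [IsProbabilityMeasure ρ] {μ : Measure β} [SFinite μ] {p : ℝ≥0∞} (hp : 1 ≤ p)
    {G : α → β → E} (hG : StronglyMeasurable (Function.uncurry G)) {K : ℝ≥0∞}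
    (hK : ∀ᵐ s ∂ρ, eLpNorm (G s) p μ ≤ K) :
    eLpNorm (fun t => ∫ s, G s t ∂ρ) p μ ≤ K := by
  have hE : Measurable (fun z : α × β => ‖G z.1 z.2‖ₑ) := hG.enorm
  have hsec : ∀ t, ‖∫ s, G s t ∂ρ‖ₑ ≤ eLpNorm (fun s => G s t) p ρ := fun t => by
    have hm : StronglyMeasurable fun s => G s t := hG.comp_measurable measurable_prodMk_right
    refine (enorm_integral_le_lintegral_enorm _).trans ?_
    rw [← eLpNorm_one_eq_lintegral_enorm]
    exact eLpNorm_le_eLpNorm_of_exponent_le hp hm.aestronglyMeasurable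
  by_cases htop : p = ∞
  · subst htop
    simp only [eLpNorm_exponent_top] at *
    have h1 : ∀ᵐ s ∂ρ, ∀ᵐ t ∂μ, ‖G s t‖ₑ ≤ K := hK.mono fun s hs =>
      (ae_le_eLpNormEssSup (f := G s)).mono fun t ht => ht.trans hs
    have h2 := (Measure.ae_ae_comm (μ := ρ) (ν := μ) (p := fun s t => ‖G s t‖ₑ ≤ K)
      (measurableSet_le hE measurable_const)).1 h1
    exact eLpNormEssSup_le_of_ae_enorm_bound <| h2.mono fun t ht =>
      (hsec t).trans (eLpNormEssSup_le_of_ae_enorm_bound ht)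
  · have hp0 : p ≠ 0 := (zero_lt_one.trans_le hp).ne'
    have hq : 0 < p.toReal := ENNReal.toReal_pos hp0 htop
    simp only [eLpNorm_eq_lintegral_rpow_enorm_toReal hp0 htop, one_div,
      ENNReal.rpow_inv_le_iff hq] at *
    calc ∫⁻ t, ‖∫ s, G s t ∂ρ‖ₑ ^ p.toReal ∂μ
        ≤ ∫⁻ t, ∫⁻ s, ‖G s t‖ₑ ^ p.toReal ∂ρ ∂μ := lintegral_mono fun t => by
          rw [← ENNReal.le_rpow_inv_iff hq]; exact hsec t
      _ = ∫⁻ s, ∫⁻ t, ‖G s t‖ₑ ^ p.toReal ∂μ ∂ρ :=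
          (lintegral_lintegral_swap (hE.pow_const _).aemeasurable).symm
      _ ≤ ∫⁻ _, K ^ p.toReal ∂ρ := lintegral_mono_ae hK
      _ = K ^ p.toReal := by simp

lemma eLpNorm_smul_comp_add_le {J : Set ℝ} (hJm : MeasurableSet J) (hJu : IsUpperSet J)
    {p : ℝ≥0∞} {v : ℝ → ℝ} (hv0 : ∀ t, 0 ≤ v t) (hvm : Measurable v) {C r : ℝ} (hr : 0 ≤ r)
    (hv : ∀ᵐ t ∂(volume.restrict J), v t ≤ C * v (t + r))
    {f : ℝ → E} (hf : StronglyMeasurable f) :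
    eLpNorm (fun t => v t • f (t + r)) p (volume.restrict J)
      ≤ ENNReal.ofReal C * eLpNorm (fun t => v t • f t) p (volume.restrict J) := by
  have hnorm : ∀ᵐ t ∂(volume.restrict J),
      ‖v t • f (t + r)‖ ≤ C * ‖v (t + r) • f (t + r)‖ := hv.mono fun t ht => by
    rw [norm_smul, norm_smul, Real.norm_of_nonneg (hv0 _), Real.norm_of_nonneg (hv0 _), ← mul_assoc]
    gcongr
  refine (eLpNorm_le_mul_eLpNorm_of_ae_le_mul hnorm p).trans ?_
  gcongr
  exact eLpNorm_comp_add_restrict_le (g := fun t => v t • f t) hJm hJu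
    (hvm.stronglyMeasurable.smul hf) hr

/-- A function that is finite on `(0, ∞)` is bounded by some `K` at two points at any prescribed
distance `s ≤ 1`. -/
lemma exists_uniform_bound_pair {N : ℝ → ℝ≥0∞} (hN : ∀ K, MeasurableSet {s | N s ≤ K})
    (hfin : ∀ s, 0 < s → N s < ∞) :
    ∃ K : ℝ≥0∞, K < ∞ ∧ ∀ s ∈ Ioc (0 : ℝ) 1, ∃ r, N r ≤ K ∧ N (s + r) ≤ K := by
  let D : ℕ → Set ℝ := fun n => Ioc 0 2 ∩ {s | N s ≤ n}ᶜ
  have hanti : Antitone D := fun m n hmn s hs =>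
    ⟨hs.1, fun h => hs.2 (h.trans (Nat.cast_le.2 hmn) : N s ≤ n)⟩
  have hlim := tendsto_measure_iInter_atTop (μ := volume) (s := D)
    (fun n => (measurableSet_Ioc.inter (hN n).compl).nullMeasurableSet) hanti
    ⟨0, ((measure_mono inter_subset_left).trans_lt measure_Ioc_lt_top).ne⟩
  have hempty : ⋂ n, D n = ∅ := by
    refine eq_empty_of_forall_notMem fun s hs => ?_
    rw [mem_iInter] at hs
    obtain ⟨n, hn⟩ := ENNReal.exists_nat_gt (hfin s (hs 0).1.1).ne
    exact (hs n).2 hn.le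
  rw [hempty, measure_empty] at hlim
  obtain ⟨n, hn⟩ := (hlim.eventually_lt_const
    (show (0 : ℝ≥0∞) < 2⁻¹ by simp)).exists
  refine ⟨n, ENNReal.natCast_lt_top n, fun s hs => ?_⟩
  by_contra! hcon
  have hsub : Ioc (0 : ℝ) 1 ⊆ D n ∪ (s + ·) ⁻¹' D n := fun r hr => by
    by_cases h : N r ≤ n
    · refine Or.inr ⟨⟨by linarith [hs.1, hr.1], by linarith [hs.2, hr.2]⟩, ?_⟩
      exact not_le.2 (hcon r h)
    · exact Or.inl ⟨⟨hr.1, by linarith [hr.2]⟩, h⟩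
  have h1 : volume (Ioc (0 : ℝ) 1) < 1 := by
    calc volume (Ioc (0 : ℝ) 1) ≤ volume (D n) + volume ((s + ·) ⁻¹' D n) :=
          (measure_mono hsub).trans (measure_union_le _ _)
      _ < 2⁻¹ + 2⁻¹ := by rw [measure_preimage_add]; exact ENNReal.add_lt_add hn hn
      _ = 1 := ENNReal.inv_two_add_inv_two
  simp at h1

lemma exists_bound_of_quasi_subadditive {N : ℝ → ℝ≥0∞} {A : ℝ≥0∞} (hA : A < ∞)
    (hN : ∀ K, MeasurableSet {s | N s ≤ K}) (hfin : ∀ s, 0 < s → N s < ∞)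
    (hadd : ∀ s, ∀ r ∈ Ioc (0 : ℝ) 1, N (s + r) ≤ A * N s + N r)
    (hsub : ∀ s ∈ Ioc (0 : ℝ) 1, ∀ r, N s ≤ N (s + r) + A * N r) (n : ℕ) :
    ∃ K : ℝ≥0∞, K < ∞ ∧ ∀ s ∈ Ioc (0 : ℝ) (n + 1), N s ≤ K := by
  induction n with
  | zero =>
    obtain ⟨K, hK, hKs⟩ := exists_uniform_bound_pair hN hfin
    refine ⟨K + A * K, by finiteness, fun s hs => ?_⟩
    have hs' : s ∈ Ioc (0 : ℝ) 1 := by simpa using hs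
    obtain ⟨r, hr1, hr2⟩ := hKs s hs'
    exact (hsub s hs' r).trans (by gcongr)
  | succ n ih =>
    obtain ⟨K, hK, hKs⟩ := ih
    have hN1 : N 1 < ∞ := hfin 1 one_pos
    refine ⟨K + (A * K + N 1), by finiteness, fun s hs => ?_⟩
    push_cast at hs
    by_cases hsn : s ≤ n + 1
    · exact (hKs s ⟨hs.1, hsn⟩).trans le_self_add
    · have hn : (0 : ℝ) ≤ n := n.cast_nonneg
      have hK' : N (s - 1) ≤ K := hKs _ ⟨by linarith, by linarith [hs.2]⟩
      calc N s = N (s - 1 + 1) := by rw [sub_add_cancel]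
        _ ≤ A * N (s - 1) + N 1 := hadd _ 1 ⟨one_pos, le_rfl⟩
        _ ≤ A * K + N 1 := by gcongr
        _ ≤ K + (A * K + N 1) := le_add_self

/-- If all differences of `f` have finite weighted `L^p` norm, these norms are bounded for steps in
bounded intervals. -/
lemma exists_bound_eLpNorm_smul_diff {J : Set ℝ} (hJm : MeasurableSet J) (hJu : IsUpperSet J)
    {p : ℝ≥0∞} (hp : 1 ≤ p) {v : ℝ → ℝ} (hv0 : ∀ t, 0 ≤ v t) (hvm : Measurable v) {C : ℝ}
    (hv : ∀ r ∈ Ioc (0 : ℝ) 1, ∀ᵐ t ∂(volume.restrict J), v t ≤ C * v (t + r))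
    {f : ℝ → E} (hf : StronglyMeasurable f)
    (hfin : ∀ s, 0 < s → eLpNorm (fun t => v t • (f (t + s) - f t)) p (volume.restrict J) < ∞)
    (n : ℕ) :
    ∃ K : ℝ≥0∞, K < ∞ ∧ ∀ s ∈ Ioc (0 : ℝ) (n + 1),
      eLpNorm (fun t => v t • (f (t + s) - f t)) p (volume.restrict J) ≤ K := by
  have hfs : ∀ s, StronglyMeasurable fun t => f (t + s) - f t := fun s =>
    (hf.comp_measurable (measurable_add_const s)).sub hf
  have hvm' : StronglyMeasurable v := hvm.stronglyMeasurable
  have hvf : ∀ s r, AEStronglyMeasurable (fun t => v t • (f (t + r + s) - f (t + r)))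
      (volume.restrict J) := fun s r => by
    have h : StronglyMeasurable fun t => f (t + r + s) - f (t + r) :=
      (hfs s).comp_measurable (measurable_add_const r)
    exact (hvm'.smul h).aestronglyMeasurable
  have hvf0 : ∀ s, AEStronglyMeasurable (fun t => v t • (f (t + s) - f t))
      (volume.restrict J) := fun s => (hvm'.smul (hfs s)).aestronglyMeasurable
  have hshift : ∀ r ∈ Ioc (0 : ℝ) 1, ∀ s,
      eLpNorm (fun t => v t • (f (t + r + s) - f (t + r))) p (volume.restrict J)
        ≤ ENNReal.ofReal C * eLpNorm (fun t => v t • (f (t + s) - f t)) p (volume.restrict J) :=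
    fun r hr s => eLpNorm_smul_comp_add_le (f := fun t => f (t + s) - f t) hJm hJu hv0 hvm
      hr.1.le (hv r hr) (hfs s)
  refine exists_bound_of_quasi_subadditive (A := ENNReal.ofReal C)
    (N := fun s => eLpNorm (fun t => v t • (f (t + s) - f t)) p (volume.restrict J))
    ENNReal.ofReal_lt_top ?_ hfin (fun s r hr => ?_) (fun s hs r => ?_) n
  · have hG : StronglyMeasurable
        (Function.uncurry fun s t : ℝ => v t • (f (t + s) - f t)) :=
      (hvm.stronglyMeasurable.comp_measurable measurable_snd).smul
        ((hf.comp_measurable (measurable_snd.add measurable_fst)).sub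
          (hf.comp_measurable measurable_snd))
    exact fun K => measurableSet_eLpNorm_section_le hp hG K
  · have heq : (fun t => v t • (f (t + (s + r)) - f t))
        = (fun t => v t • (f (t + r + s) - f (t + r))) + fun t => v t • (f (t + r) - f t) := by
      ext t
      rw [Pi.add_apply, ← smul_add, sub_add_sub_cancel, add_comm s r, add_assoc]
    rw [heq]
    refine (eLpNorm_add_le (hvf _ _) (hvf0 _) hp).trans ?_
    gcongr
    exact hshift r hr s
  · have heq : (fun t => v t • (f (t + s) - f t)) = (fun t => v t • (f (t + (s + r)) - f t))
        - fun t => v t • (f (t + s + r) - f (t + s)) := by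
      ext t
      rw [Pi.sub_apply, ← smul_sub, ← add_assoc, sub_sub_sub_cancel_left]
    rw [heq]
    refine (eLpNorm_sub_le (hvf0 _) (hvf _ _) hp).trans ?_
    gcongr
    exact hshift s hs r

/-- The function `v` for which `memLpw J w p f` means that `v • f` is in `L^p`. -/
noncomputable def lpWeight (w : ℝ → ℝ) (p : ℝ≥0∞) (t : ℝ) : ℝ :=
  if p = ∞ then w t else w t ^ p.toReal⁻¹

lemma lpWeight_nonneg {w : ℝ → ℝ} (hw0 : ∀ t, 0 ≤ w t) (p : ℝ≥0∞) (t : ℝ) :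
    0 ≤ lpWeight w p t := by
  unfold lpWeight
  split_ifs
  exacts [hw0 t, Real.rpow_nonneg (hw0 t) _]

lemma measurable_lpWeight {w : ℝ → ℝ} (hw : Measurable w) (p : ℝ≥0∞) :
    Measurable (lpWeight w p) := by
  unfold lpWeight
  split_ifs
  exacts [hw, hw.pow_const _]

lemma lpWeight_le_mul {w : ℝ → ℝ} (hw0 : ∀ t, 0 ≤ w t) {c : ℝ} (hc : 0 ≤ c) (p : ℝ≥0∞) {t u : ℝ}
    (h : w t ≤ c * w u) : lpWeight w p t ≤ lpWeight (fun _ => c) p 0 * lpWeight w p u := by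
  unfold lpWeight
  split_ifs
  · exact h
  · rw [← Real.mul_rpow hc (hw0 u)]
    exact Real.rpow_le_rpow (hw0 t) h (by positivity)

lemma memLpw_iff {J : Set ℝ} {w : ℝ → ℝ} (hw0 : ∀ t, 0 ≤ w t) {p : ℝ≥0∞} (hp : 1 ≤ p)
    {f : ℝ → E} :
    memLpw J w p f ↔ AEStronglyMeasurable f (volume.restrict J) ∧
      eLpNorm (fun t => lpWeight w p t • f t) p (volume.restrict J) < ∞ := by
  unfold memLpw lpWeight
  refine and_congr_right fun _ => ?_
  split_ifs with htop
  · subst htop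
    rw [eLpNorm_exponent_top]
    have hnorm : ∀ t, ‖w t • f t‖ = w t * ‖f t‖ := fun t => by
      rw [norm_smul, Real.norm_of_nonneg (hw0 t)]
    constructor
    · rintro ⟨C, hC⟩
      exact eLpNormEssSup_lt_top_of_ae_bound (C := C) (by simpa only [hnorm] using hC)
    · intro h
      refine ⟨(eLpNormEssSup (fun t => w t • f t) (volume.restrict J)).toReal, ?_⟩
      refine (ae_le_eLpNormEssSup (f := fun t => w t • f t)).mono fun t ht => ?_
      rw [← hnorm, ← toReal_enorm]
      exact ENNReal.toReal_mono h.ne ht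
  · have hp0 : p ≠ 0 := (zero_lt_one.trans_le hp).ne'
    have hq : 0 < p.toReal := ENNReal.toReal_pos hp0 htop
    rw [eLpNorm_lt_top_iff_lintegral_rpow_enorm_lt_top hp0 htop]
    refine iff_of_eq (congrArg (· < ∞) (lintegral_congr fun t => ?_))
    have hv := Real.rpow_nonneg (hw0 t) p.toReal⁻¹
    rw [← ofReal_norm, ENNReal.ofReal_rpow_of_nonneg (norm_nonneg _) hq.le, norm_smul,
      Real.norm_of_nonneg hv, Real.mul_rpow hv (norm_nonneg _), ← Real.rpow_mul (hw0 t),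
      inv_mul_cancel₀ hq.ne', Real.rpow_one]

lemma sub_meanM_eq {J : Set ℝ} (hJu : IsUpperSet J) {f φ : ℝ → E}
    (hφ : LocallyIntegrableOn φ J) (hfφ : f =ᵐ[volume.restrict J] φ) {h : ℝ} (hh : 0 < h)
    {t : ℝ} (ht : t ∈ J) [CompleteSpace E] :
    f t - meanM h φ t
      = -∫ s, (f (t + s) - f t) ∂(ENNReal.ofReal h⁻¹ • volume.restrict (Ioc 0 h)) := by
  have hsub : Icc t (t + h) ⊆ J := fun u hu => hJu hu.1 ht
  have hint : IntervalIntegrable φ volume t (t + h) :=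
    (intervalIntegrable_iff_integrableOn_Icc_of_le (by linarith)).2
      (hφ.integrableOn_compact_subset hsub isCompact_Icc)
  have hae : ∀ᵐ u ∂(volume.restrict (uIoc t (t + h))), φ u = f u := by
    rw [uIoc_of_le (by linarith)]
    exact ae_mono (Measure.restrict_mono (Ioc_subset_Icc_self.trans hsub) le_rfl) hfφ.symm
  have hintf : IntervalIntegrable (fun s => f (t + s)) volume 0 h := by
    have := (hint.congr_ae hae).comp_add_left t
    simpa using this
  have hmean : ∫ s in (0 : ℝ)..h, φ (t + s) = ∫ s in (0 : ℝ)..h, f (t + s) := by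
    rw [intervalIntegral.integral_comp_add_left φ, intervalIntegral.integral_comp_add_left f,
      add_zero]
    exact intervalIntegral.integral_congr_ae_restrict hae
  rw [meanM, hmean, integral_smul_measure, ENNReal.toReal_ofReal (by positivity),
    ← intervalIntegral.integral_of_le hh.le, intervalIntegral.integral_sub hintf (by simp),
    intervalIntegral.integral_const, sub_zero, smul_sub, smul_smul, inv_mul_cancel₀ hh.ne',
    one_smul, one_div]
  abel

end WeightedDifferences

/-- Proposition 4.9.  `L^p_w(𝕁,X)` satisfies condition (Δ), for
`1 ≤ p ≤ ∞` and measurable weights `w : 𝕁 → [0,∞)` with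
`w(t+h) ≤ c·w(t)` and `w(t) ≤ c·w(t+h)` a.e. in `t ∈ 𝕁` for all `0 < h ≤ 1`. -/
theorem prop_4_9 {X : Type*} [NormedAddCommGroup X] [NormedSpace ℝ X] [CompleteSpace X]
    (J : Set ℝ)
    (hJ : J = Set.univ ∨ (∃ α : ℝ, J = Set.Ioi α) ∨ (∃ α : ℝ, J = Set.Ici α))
    (p : ℝ≥0∞) (hp : 1 ≤ p)
    (w : ℝ → ℝ) (hw0 : ∀ t, 0 ≤ w t) (hwmeas : Measurable w)
    (c : ℝ) (hc : 0 < c)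
    (hcw : ∀ h ∈ Set.Ioc (0 : ℝ) 1, ∀ᵐ t ∂(volume.restrict J),
      w (t + h) ≤ c * w t ∧ w t ≤ c * w (t + h)) :
    ∀ φ : ℝ → X, LocallyIntegrableOn φ J →
      (∀ s : ℝ, 0 < s → memLpw J w p (fun t => φ (t + s) - φ t)) →
      ∀ h : ℝ, 0 < h → memLpw J w p (fun t => φ t - meanM h φ t) := by
  intro φ hφ hΔ h hh
  have hJm : MeasurableSet J := by
    rcases hJ with rfl | ⟨α, rfl⟩ | ⟨α, rfl⟩
    exacts [MeasurableSet.univ, measurableSet_Ioi, measurableSet_Ici]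
  have hJu : IsUpperSet J := by
    rcases hJ with rfl | ⟨α, rfl⟩ | ⟨α, rfl⟩
    exacts [isUpperSet_univ, isUpperSet_Ioi α, isUpperSet_Ici α]
  obtain ⟨f, hf, hφf⟩ := hφ.aestronglyMeasurable
  let v := lpWeight w p
  have hv0 : ∀ t, 0 ≤ v t := lpWeight_nonneg hw0 p
  have hvm : Measurable v := measurable_lpWeight hwmeas p
  have hv : ∀ r ∈ Ioc (0 : ℝ) 1, ∀ᵐ t ∂(volume.restrict J),
      v t ≤ lpWeight (fun _ => c) p 0 * v (t + r) := fun r hr =>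
    (hcw r hr).mono fun t ht => lpWeight_le_mul hw0 hc.le p ht.2
  have hshift : ∀ s, 0 < s → ∀ᵐ t ∂(volume.restrict J), φ (t + s) = f (t + s) := fun s hs => by
    have hmp := (measurePreserving_add_right (volume : Measure ℝ) s).restrict_preimage hJm
    exact ae_mono (Measure.restrict_mono (hJu.subset_preimage_add_const hs.le) le_rfl)
      (hmp.quasiMeasurePreserving.ae hφf)
  have hfin : ∀ s, 0 < s →
      eLpNorm (fun t => v t • (f (t + s) - f t)) p (volume.restrict J) < ∞ := fun s hs => by
    refine (eLpNorm_congr_ae ?_).trans_lt ((memLpw_iff hw0 hp).1 (hΔ s hs)).2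
    filter_upwards [hφf, hshift s hs] with t h1 h2
    rw [h1, h2]
  obtain ⟨n, hn⟩ := exists_nat_ge h
  obtain ⟨K, hK, hKs⟩ := exists_bound_eLpNorm_smul_diff hJm hJu hp hv0 hvm hv hf hfin n
  set ρ : Measure ℝ := ENNReal.ofReal h⁻¹ • volume.restrict (Ioc 0 h) with hρ
  have hρ1 : IsProbabilityMeasure ρ := ⟨by
    simp [hρ, ← ENNReal.ofReal_mul (inv_nonneg.2 hh.le), inv_mul_cancel₀ hh.ne']⟩
  have hdiff : StronglyMeasurable (fun z : ℝ × ℝ => f (z.2 + z.1) - f z.2) :=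
    (hf.comp_measurable (measurable_snd.add measurable_fst)).sub (hf.comp_measurable measurable_snd)
  have hrepr : ∀ᵐ t ∂(volume.restrict J),
      φ t - meanM h φ t = -∫ s, (f (t + s) - f t) ∂ρ := by
    filter_upwards [hφf, ae_restrict_mem hJm] with t h1 ht
    rw [h1, sub_meanM_eq hJu hφ hφf.symm hh ht]
  refine (memLpw_iff hw0 hp).2 ⟨?_, ?_⟩
  · have hmeas : StronglyMeasurable fun t => ∫ s, (f (t + s) - f t) ∂ρ :=
      (hdiff.comp_measurable measurable_swap).integral_prod_right'
    exact hmeas.neg.aestronglyMeasurable.congr (Filter.EventuallyEq.symm hrepr)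
  · have hle := eLpNorm_integral_le_of_ae_le (ρ := ρ) (μ := volume.restrict J) hp
      (G := fun s t => v t • (f (t + s) - f t))
      ((hvm.stronglyMeasurable.comp_measurable measurable_snd).smul hdiff) (K := K) (by
        refine Measure.ae_smul_measure ?_ _
        filter_upwards [ae_restrict_mem measurableSet_Ioc] with s hs
        exact hKs s ⟨hs.1, by linarith [hs.2]⟩)
    refine lt_of_eq_of_lt ?_ (hle.trans_lt hK)
    rw [← eLpNorm_neg]
    refine eLpNorm_congr_ae (hrepr.mono fun t ht => ?_)
    simp only [Pi.neg_apply, ht, integral_smul, smul_neg, neg_neg, v]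
end

section
/- Let 𝕁 be an interval of the form ℝ, (α,∞) or [α,∞), X a Banach space and ε₀ > 0. If φ : 𝕁 → X is strongly measurable and Δ_h φ ∈ L¹_loc(𝕁,X) for all h ∈ (0, ε₀], then φ ∈ L¹_loc(𝕁,X). -/
open MeasureTheory Set

lemma exists_nat_measure_inter_norm_gt_lt {X α : Type*} [NormedAddCommGroup X]
    [MeasurableSpace α] {μ : Measure α} {ψ : α → X} (hψ : StronglyMeasurable ψ)
    {S : Set α} (hS : MeasurableSet S) (hμS : μ S ≠ ⊤) {c : ENNReal} (hc : 0 < c) :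
    ∃ N : ℕ, μ (S ∩ {s | (N : ℝ) < ‖ψ s‖}) < c := by
  have hlim := tendsto_measure_iInter_atTop (μ := μ)
    (s := fun N : ℕ => S ∩ {s | (N : ℝ) < ‖ψ s‖})
    (fun N => (hS.inter (measurableSet_lt measurable_const hψ.norm.measurable)).nullMeasurableSet)
    (fun m n hmn s hs => ⟨hs.1, (Nat.cast_le.2 hmn).trans_lt (mem_ofPred.1 hs.2)⟩)
    ⟨0, measure_ne_top_of_subset inter_subset_left hμS⟩
  have hempty : ⋂ N : ℕ, S ∩ {s | (N : ℝ) < ‖ψ s‖} = ∅ := by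
    refine eq_empty_iff_forall_notMem.2 fun s hs => ?_
    obtain ⟨n, hn⟩ := exists_nat_ge ‖ψ s‖
    exact absurd (mem_iInter.1 hs n).2 (not_lt.2 hn)
  rw [hempty, measure_empty] at hlim
  exact (hlim.eventually_lt_const hc).exists

lemma exists_measurableSet_bounded_of_lt_top {G : ℝ → ENNReal} (hG : Measurable G)
    {ε : ℝ} (hε : 0 < ε) (hfin : ∀ h ∈ Ioc 0 ε, G h < ⊤) :
    ∃ (H : Set ℝ) (M : ℕ), MeasurableSet H ∧ H ⊆ Ioc 0 ε ∧ 0 < volume H ∧ ∀ h ∈ H, G h ≤ M := by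
  have hcover : Ioc 0 ε ⊆ ⋃ n : ℕ, Ioc 0 ε ∩ {h | G h ≤ n} := by
    intro h hh
    obtain ⟨n, hn⟩ := ENNReal.exists_nat_gt (hfin h hh).ne
    exact mem_iUnion.2 ⟨n, hh, hn.le⟩
  have hpos : volume (⋃ n : ℕ, Ioc 0 ε ∩ {h | G h ≤ n}) ≠ 0 := by
    refine (lt_of_lt_of_le ?_ (measure_mono hcover)).ne'
    simpa using hε
  obtain ⟨n, hn⟩ := exists_measure_pos_of_not_measure_iUnion_null hpos
  exact ⟨_, n, measurableSet_Ioc.inter (measurableSet_le hG measurable_const),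
    inter_subset_left, hn, fun h hh => hh.2⟩

open scoped Pointwise in
/-- If the differences of a strongly measurable function are integrable on a compact set for all
small positive increments, then so is the function itself. -/
lemma lintegral_enorm_lt_top_of_forall_sub {X : Type*} [NormedAddCommGroup X]
    {ψ : ℝ → X} (hψ : StronglyMeasurable ψ) {K : Set ℝ} (hK : IsCompact K)
    {ε : ℝ} (hε : 0 < ε)
    (hfin : ∀ h ∈ Ioc 0 ε, ∫⁻ t in K, ‖ψ (t + h) - ψ t‖ₑ < ⊤) :
    ∫⁻ t in K, ‖ψ t‖ₑ < ⊤ := by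
  have hmeas : Measurable (fun p : ℝ × ℝ => ‖ψ (p.2 + p.1) - ψ p.2‖ₑ) :=
    ((hψ.comp_measurable (measurable_snd.add measurable_fst)).sub
      (hψ.comp_measurable measurable_snd)).enorm
  obtain ⟨H, M, hH, hHε, hHpos, hHM⟩ :=
    exists_measurableSet_bounded_of_lt_top (hmeas.lintegral_prod_right' (ν := volume.restrict K))
      hε hfin
  have hHtop : volume H < ⊤ := (measure_mono hHε).trans_lt (by simp)
  have hS : IsCompact (K + Icc 0 ε) := hK.add isCompact_Icc
  obtain ⟨N, hN⟩ := exists_nat_measure_inter_norm_gt_lt (μ := volume) hψ hS.measurableSet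
    hS.measure_lt_top.ne (ENNReal.half_pos hHpos.ne')
  have key : ∀ t ∈ K, volume H / 2 * ‖ψ t‖ₑ ≤ ∫⁻ h in H, (‖ψ (t + h) - ψ t‖ₑ + N) := by
    intro t ht
    have hgood : MeasurableSet {h | ‖ψ (t + h)‖ ≤ (N : ℝ)} :=
      measurableSet_le (hψ.comp_measurable (measurable_const_add t)).norm.measurable
        measurable_const
    have hbad : volume (H \ {h | ‖ψ (t + h)‖ ≤ (N : ℝ)}) ≤ volume H / 2 := by
      refine le_trans ?_ hN.le
      rw [← measure_preimage_add volume t ((K + Icc 0 ε) ∩ _)]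
      refine measure_mono fun h hh => ⟨?_, ?_⟩
      · exact add_mem_add ht (Ioc_subset_Icc_self (hHε hh.1))
      · simpa using hh.2
    have hlarge : volume H / 2 ≤ volume (H ∩ {h | ‖ψ (t + h)‖ ≤ (N : ℝ)}) := by
      have hsplit := measure_inter_add_sdiff (μ := volume) H hgood
      by_contra! hlt
      have hsum := ENNReal.add_lt_add_of_lt_of_le
        (measure_ne_top_of_subset sdiff_subset hHtop.ne) hlt hbad
      rw [hsplit, ENNReal.add_halves] at hsum
      exact lt_irrefl _ hsum
    calc volume H / 2 * ‖ψ t‖ₑ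
        ≤ volume (H ∩ {h | ‖ψ (t + h)‖ ≤ (N : ℝ)}) * ‖ψ t‖ₑ := by gcongr
      _ = ∫⁻ _ in H ∩ {h | ‖ψ (t + h)‖ ≤ (N : ℝ)}, ‖ψ t‖ₑ := by
          rw [setLIntegral_const, mul_comm]
      _ ≤ ∫⁻ h in H ∩ {h | ‖ψ (t + h)‖ ≤ (N : ℝ)}, (‖ψ (t + h) - ψ t‖ₑ + N) := by
          refine setLIntegral_mono' (hH.inter hgood) fun h hh => ?_
          have hle : ‖ψ (t + h)‖ₑ ≤ N := by
            rw [← ofReal_norm, ← ENNReal.ofReal_natCast]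
            exact ENNReal.ofReal_le_ofReal hh.2
          calc ‖ψ t‖ₑ = ‖ψ (t + h) - (ψ (t + h) - ψ t)‖ₑ := by rw [sub_sub_cancel]
            _ ≤ ‖ψ (t + h)‖ₑ + ‖ψ (t + h) - ψ t‖ₑ := enorm_sub_le
            _ ≤ ‖ψ (t + h) - ψ t‖ₑ + N := by rw [add_comm]; gcongr
      _ ≤ ∫⁻ h in H, (‖ψ (t + h) - ψ t‖ₑ + N) := lintegral_mono_set inter_subset_left
  have hbound : volume H / 2 * ∫⁻ t in K, ‖ψ t‖ₑ < ⊤ := by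
    calc volume H / 2 * ∫⁻ t in K, ‖ψ t‖ₑ
        = ∫⁻ t in K, volume H / 2 * ‖ψ t‖ₑ := (lintegral_const_mul _ hψ.enorm).symm
      _ ≤ ∫⁻ t in K, ∫⁻ h in H, (‖ψ (t + h) - ψ t‖ₑ + N) :=
          setLIntegral_mono' hK.measurableSet key
      _ = ∫⁻ h in H, ∫⁻ t in K, (‖ψ (t + h) - ψ t‖ₑ + N) :=
          lintegral_lintegral_swap
            ((hmeas.comp measurable_swap).add measurable_const).aemeasurable
      _ ≤ ∫⁻ _ in H, (M + N * volume K) := by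
          refine setLIntegral_mono' hH fun h hh => ?_
          rw [lintegral_add_right _ measurable_const, setLIntegral_const]
          gcongr
          exact hHM h hh
      _ = (M + N * volume K) * volume H := setLIntegral_const _ _
      _ < ⊤ := ENNReal.mul_lt_top (ENNReal.add_lt_top.2 ⟨ENNReal.natCast_lt_top M,
          ENNReal.mul_lt_top (ENNReal.natCast_lt_top N) hK.measure_lt_top⟩) hHtop
  exact ENNReal.lt_top_of_mul_ne_top_right hbound.ne (ENNReal.half_pos hHpos.ne').ne'

/-- Lemma 4.19.  If `φ : 𝕁 → X` is strongly measurable and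
`Δ_h φ ∈ L¹_loc(𝕁,X)` for all `h ∈ (0, ε₀]`, then `φ ∈ L¹_loc(𝕁,X)`. -/
theorem lem_4_19 {X : Type*} [NormedAddCommGroup X] [NormedSpace ℝ X] [CompleteSpace X]
    (J : Set ℝ)
    (hJ : J = Set.univ ∨ (∃ α : ℝ, J = Set.Ioi α) ∨ (∃ α : ℝ, J = Set.Ici α))
    (ε₀ : ℝ) (hε₀ : 0 < ε₀)
    (φ : ℝ → X) (hmeas : AEStronglyMeasurable φ (volume.restrict J))
    (hΔ : ∀ h ∈ Set.Ioc (0 : ℝ) ε₀,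
      LocallyIntegrableOn (fun t => φ (t + h) - φ t) J) :
    LocallyIntegrableOn φ J := by
  have hJ_closed : IsLocallyClosed J := by
    rcases hJ with rfl | ⟨α, rfl⟩ | ⟨α, rfl⟩
    · exact isOpen_univ.isLocallyClosed
    · exact isOpen_Ioi.isLocallyClosed
    · exact isClosed_Ici.isLocallyClosed
  have hJ_meas : MeasurableSet J := by
    rcases hJ with rfl | ⟨α, rfl⟩ | ⟨α, rfl⟩
    · exact MeasurableSet.univ
    · exact measurableSet_Ioi
    · exact measurableSet_Ici
  have hJ_add : ∀ t ∈ J, ∀ h, 0 < h → t + h ∈ J := by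
    rcases hJ with rfl | ⟨α, rfl⟩ | ⟨α, rfl⟩ <;> intro t ht h hh
    · trivial
    · simp only [mem_Ioi] at *; linarith
    · simp only [mem_Ici] at *; linarith
  obtain ⟨ψ, hψ, hφψ⟩ := hmeas
  have hae : ∀ᵐ t, t ∈ J → φ t = ψ t := (ae_restrict_iff' hJ_meas).1 hφψ
  rw [locallyIntegrableOn_iff hJ_closed]
  intro K hKJ hK
  have hφψK : φ =ᵐ[volume.restrict K] ψ := ae_restrict_of_ae_restrict_of_subset hKJ hφψ
  refine IntegrableOn.congr_fun_ae (f := ψ) ⟨hψ.aestronglyMeasurable, ?_⟩ hφψK.symm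
  refine lintegral_enorm_lt_top_of_forall_sub hψ hK hε₀ fun h hh => ?_
  have hshift : ∀ᵐ t, t + h ∈ J → φ (t + h) = ψ (t + h) :=
    (measurePreserving_add_right volume h).quasiMeasurePreserving.ae hae
  have hint := ((hΔ h hh).integrableOn_compact_subset hKJ hK).2
  refine lt_of_eq_of_lt (lintegral_congr_ae ?_) hint
  filter_upwards [hφψK, ae_restrict_of_ae hshift, ae_restrict_mem hK.measurableSet]
    with t ht hth htK
  rw [ht, hth (hJ_add t (hKJ htK) h hh.1)]
end

section
/- Let 𝕁 be an interval of the form ℝ, (α,∞) or [α,∞), X a Banach space, and let 𝒜 ⊆ L¹_loc(𝕁,X) be uniformly closed. Then for all n, k ∈ ℕ₀, (M^{n+k}𝒜) ∩ M^{k}C_u(𝕁,X) ⊆ M^{k}𝒜. In particular, a function in M^{n}𝒜 that is uniformly continuous on 𝕁 already belongs to 𝒜. -/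
open MeasureTheory Set Filter
open scoped Topology

theorem intervalIntegrable_add_left_of_continuousOn {X : Type*} [NormedAddCommGroup X]
    {J : Set ℝ} (hJ : ∀ t ∈ J, ∀ s : ℝ, 0 ≤ s → t + s ∈ J) {φ : ℝ → X}
    (hφ : ContinuousOn φ J) {t h : ℝ} (ht : t ∈ J) (hh : 0 ≤ h) :
    IntervalIntegrable (fun s => φ (t + s)) volume 0 h := by
  refine ContinuousOn.intervalIntegrable (hφ.comp (by fun_prop) fun s hs => ?_)
  rw [uIcc_of_le hh] at hs
  exact hJ t ht s hs.1

theorem norm_inv_smul_intervalIntegral_le {X : Type*} [NormedAddCommGroup X] [NormedSpace ℝ X]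
    {g : ℝ → X} {h C : ℝ} (hh : 0 < h) (hg : ∀ s, 0 ≤ s → s ≤ h → ‖g s‖ ≤ C) :
    ‖(1 / h) • ∫ s in (0 : ℝ)..h, g s‖ ≤ C := by
  have hint : ‖∫ s in (0 : ℝ)..h, g s‖ ≤ C * |h - 0| := by
    refine intervalIntegral.norm_integral_le_of_norm_le_const fun s hs => ?_
    rw [uIoc_of_le hh.le] at hs
    exact hg s hs.1.le hs.2
  rw [sub_zero, abs_of_pos hh] at hint
  rw [norm_smul, Real.norm_of_nonneg (by positivity), one_div, inv_mul_le_iff₀ hh, mul_comm h]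
  exact hint

theorem UniformContinuousOn.meanM {X : Type*} [NormedAddCommGroup X] [NormedSpace ℝ X]
    {J : Set ℝ} (hJ : ∀ t ∈ J, ∀ s : ℝ, 0 ≤ s → t + s ∈ J) {φ : ℝ → X}
    (hφ : UniformContinuousOn φ J) {h : ℝ} (hh : 0 < h) :
    UniformContinuousOn (meanM h φ) J := by
  rw [Metric.uniformContinuousOn_iff_le] at *
  intro ε hε
  obtain ⟨δ, hδ, hφδ⟩ := hφ ε hε
  have hcont : ContinuousOn φ J :=
    (Metric.uniformContinuousOn_iff_le.2 hφ).continuousOn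
  refine ⟨δ, hδ, fun t ht u hu htu => ?_⟩
  rw [dist_eq_norm, _root_.meanM, _root_.meanM, ← smul_sub, ← intervalIntegral.integral_sub
    (intervalIntegrable_add_left_of_continuousOn hJ hcont ht hh.le)
    (intervalIntegrable_add_left_of_continuousOn hJ hcont hu hh.le)]
  refine norm_inv_smul_intervalIntegral_le hh fun s hs _ => ?_
  rw [← dist_eq_norm]
  exact hφδ _ (hJ t ht s hs) _ (hJ u hu s hs) (by rwa [dist_add_right])

theorem UniformContinuousOn.tendstoUniformlyOn_meanM {X : Type*} [NormedAddCommGroup X]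
    [NormedSpace ℝ X] [CompleteSpace X]
    {J : Set ℝ} (hJ : ∀ t ∈ J, ∀ s : ℝ, 0 ≤ s → t + s ∈ J) {φ : ℝ → X}
    (hφ : UniformContinuousOn φ J) :
    TendstoUniformlyOn (fun h => _root_.meanM h φ) φ (𝓝[>] 0) J := by
  rw [Metric.tendstoUniformlyOn_iff]
  intro ε hε
  obtain ⟨δ, hδ, hφδ⟩ := Metric.uniformContinuousOn_iff_le.1 hφ (ε / 2) (by positivity)
  filter_upwards [Ioc_mem_nhdsGT hδ] with h ⟨hh, hhδ⟩ t ht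
  have hconst : φ t = (1 / h) • ∫ _ in (0 : ℝ)..h, φ t := by
    rw [intervalIntegral.integral_const, sub_zero, smul_smul, one_div_mul_cancel hh.ne',
      one_smul]
  have hmean : ‖_root_.meanM h φ t - φ t‖ ≤ ε / 2 := by
    conv_lhs => rw [hconst]
    rw [_root_.meanM, ← smul_sub, ← intervalIntegral.integral_sub
      (intervalIntegrable_add_left_of_continuousOn hJ hφ.continuousOn ht hh.le)
      intervalIntegrable_const]
    refine norm_inv_smul_intervalIntegral_le hh fun s hs hsh => ?_
    rw [← dist_eq_norm]
    refine hφδ _ (hJ t ht s hs) _ ht ?_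
    rw [dist_self_add_left, Real.norm_of_nonneg hs]
    exact hsh.trans hhδ
  rw [dist_comm, dist_eq_norm]
  linarith

theorem mem_of_mem_meanClassIter_of_uniformContinuousOn {X : Type*} [NormedAddCommGroup X]
    [NormedSpace ℝ X] [CompleteSpace X]
    {J : Set ℝ} (hJ : ∀ t ∈ J, ∀ s : ℝ, 0 ≤ s → t + s ∈ J) {A : Set (ℝ → X)}
    (hclosed : ∀ (F : ℕ → ℝ → X) (f : ℝ → X), (∀ n, F n ∈ A) →
      TendstoUniformlyOn F f atTop J → f ∈ A) (n : ℕ) {φ : ℝ → X}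
    (hφ : φ ∈ meanClassIter J A n) (hu : UniformContinuousOn φ J) : φ ∈ A := by
  induction n generalizing φ with
  | zero => exact hφ.1
  | succ n ih =>
    obtain ⟨h, -, hpos, hlim⟩ := exists_seq_strictAnti_tendsto (0 : ℝ)
    have hlim' : Tendsto h atTop (𝓝[>] 0) :=
      tendsto_nhdsWithin_iff.2 ⟨hlim, .of_forall hpos⟩
    refine hclosed (fun m => meanM (h m) φ) φ
      (fun m => ih (hφ.2 _ (hpos m)) (hu.meanM hJ (hpos m))) fun v hv => ?_
    exact hlim'.eventually (hu.tendstoUniformlyOn_meanM hJ v hv)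

/-- Proposition 5.6, function part.  If `𝒜 ⊆ L¹_loc(𝕁,X)` is
uniformly closed, then `(M^{n+k}𝒜) ∩ M^{k}C_u(𝕁,X) ⊆ M^{k}𝒜` for all `n, k ∈ ℕ₀`;
in particular a uniformly continuous function in `M^{n}𝒜` belongs to `𝒜`. -/
theorem prop_5_6 {X : Type*} [NormedAddCommGroup X] [NormedSpace ℝ X] [CompleteSpace X]
    (J : Set ℝ)
    (hJ : J = Set.univ ∨ (∃ α : ℝ, J = Set.Ioi α) ∨ (∃ α : ℝ, J = Set.Ici α))
    (A : Set (ℝ → X))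
    (hAL : ∀ f ∈ A, LocallyIntegrableOn f J)
    (hclosed : ∀ (F : ℕ → ℝ → X) (f : ℝ → X), (∀ n, F n ∈ A) →
      TendstoUniformlyOn F f atTop J → f ∈ A) :
    (∀ n k : ℕ,
      meanClassIter J A (n + k) ∩
          meanClassIter J {f : ℝ → X | UniformContinuousOn f J} k
        ⊆ meanClassIter J A k) ∧
    ∀ n : ℕ, ∀ φ ∈ meanClassIter J A n, UniformContinuousOn φ J → φ ∈ A := by
  have hadd : ∀ t ∈ J, ∀ s : ℝ, 0 ≤ s → t + s ∈ J := by
    rintro t ht s hs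
    rcases hJ with rfl | ⟨α, rfl⟩ | ⟨α, rfl⟩
    · trivial
    · exact lt_add_of_lt_of_nonneg ht hs
    · exact le_add_of_le_of_nonneg ht hs
  have hmem := mem_of_mem_meanClassIter_of_uniformContinuousOn hadd hclosed
  refine ⟨fun n k => ?_, fun n φ => hmem n⟩
  induction k with
  | zero => exact fun φ ⟨hφ, hu, hloc⟩ => ⟨hmem n hφ hu, hloc⟩
  | succ k ih => exact fun φ ⟨hφ, hu⟩ => ⟨hφ.1, fun h hh => ih ⟨hφ.2 h hh, hu.2 h hh⟩⟩
end
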